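/- Let ℙ be a stationary probability measure on Ω satisfying conditions ID, FE and KB, and let ℚ be an ergodic stationary probability measure on Ω satisfying conditions ID and FE. Then the specific cross entropy h_c(ℚ|ℙ) exists in [0,∞] and lim_{N→∞} Q̂_N(y,x) = h_c(ℚ|ℙ) for (ℙ⊗ℚ)-almost every pair (x,y) ∈ Ω×Ω (the limit being +∞ when h_c(ℚ|ℙ) = ∞). -/

import Mathlib

open MeasureTheory Filter Asymptotics
open scoped ENNReal Classical

noncomputable section

namespace ZM

/-- The left shift on one-sided sequences. -/
def shift {A : Type*} (x : ℕ → A) : ℕ → A := fun k => x (k + 1)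

/-- The cylinder set of all sequences starting with the word `a`. -/
def cyl {A : Type*} {n : ℕ} (a : Fin n → A) : Set (ℕ → A) := {x | ∀ i : Fin n, x i = a i}

/-- The word `x_{p+1}^{p+ℓ}` of `x` (0-based: the letters at positions `p, …, p+ℓ-1`). -/
def seg {A : Type*} (y : ℕ → A) (p ℓ : ℕ) : Fin ℓ → A := fun i => y (p + i)

/-- `w` occurs in `x` at (0-based) offset `r`. -/
def matchAt {A : Type*} (x : ℕ → A) {ℓ : ℕ} (w : Fin ℓ → A) (r : ℕ) : Prop :=
  ∀ i : Fin ℓ, x (r + i) = w i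

/-- `w` appears as a substring of `x_1^N`. -/
def appears {A : Type*} (N : ℕ) (x : ℕ → A) {ℓ : ℕ} (w : Fin ℓ → A) : Prop :=
  ∃ r, r + ℓ ≤ N ∧ matchAt x w r

/-- The waiting time `W_ℓ(w, x)`: the least (1-based) position at which `w` occurs in `x`,
`⊤` if `w` never occurs. -/
def W {A : Type*} {ℓ : ℕ} (w : Fin ℓ → A) (x : ℕ → A) : ℕ∞ :=
  sInf {r : ℕ∞ | ∃ n : ℕ, r = (n : ℕ∞) ∧ 1 ≤ n ∧ matchAt x w (n - 1)}

section ZMparsing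

variable {A : Type*}

/-- Length of the Ziv–Merhav word starting at (0-based) position `p` of `y_1^N`, with
database `x_1^N`: the longest prefix of the remaining portion of `y_1^N` appearing as a
substring of `x_1^N`, or a single letter if there is no such prefix. -/
def zmLen (N : ℕ) (x y : ℕ → A) (p : ℕ) : ℕ :=
  max 1 (sSup {ℓ | p + ℓ ≤ N ∧ appears N x (seg y p ℓ)})

/-- Starting position of the `j`-th (0-based) word of the Ziv–Merhav parsing. -/
def zmPos (N : ℕ) (x y : ℕ → A) : ℕ → ℕ
  | 0 => 0
  | j + 1 => zmPos N x y j + zmLen N x y (zmPos N x y j)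

/-- `c_N(y|x)`: the number of words in the Ziv–Merhav parsing of `y_1^N` w.r.t. `x_1^N`. -/
def cN (N : ℕ) (x y : ℕ → A) : ℕ := sInf {c | N ≤ zmPos N x y c}

/-- The Ziv–Merhav estimator `Q̂_N(y, x) = c_N(y|x) ln N / N`. -/
def ZMest (N : ℕ) (x y : ℕ → A) : ℝ := (cN N x y : ℝ) * Real.log N / N

end ZMparsing

section MeasureDefs

variable {A : Type*} [MeasurableSpace A]

/-- The measure of the cylinder of a word, as a real number. -/
def wp (μ : Measure (ℕ → A)) {n : ℕ} (a : Fin n → A) : ℝ := (μ (cyl a)).toReal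

/-- `supp ℙ`: the set of sequences all of whose prefixes have positive measure. -/
def suppSet (μ : Measure (ℕ → A)) : Set (ℕ → A) := {x | ∀ n, 0 < μ (cyl (seg x 0 n))}

/-- Condition (ID): immediate decoupling on the support, with sequence `k`. -/
def CondID (μ : Measure (ℕ → A)) (k : ℕ → ℝ) : Prop :=
  Monotone k ∧ (k =o[atTop] fun n => (n : ℝ)) ∧
    ∀ (n m : ℕ) (a : Fin n → A) (b : Fin m → A), 0 < μ (cyl a) → 0 < μ (cyl b) →
      wp μ (Fin.append a b) ≤ Real.exp (k n) * (wp μ a * wp μ b) ∧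
      (0 < μ (cyl (Fin.append a b)) →
        Real.exp (-k n) * (wp μ a * wp μ b) ≤ wp μ (Fin.append a b))

/-- Condition (FE): fast enough decay, with rate `γp < 0`. -/
def CondFE (μ : Measure (ℕ → A)) (γp : ℝ) : Prop :=
  γp < 0 ∧ ∀ᶠ n : ℕ in atTop, ∀ a : Fin n → A, 0 < μ (cyl a) → wp μ a ≤ Real.exp (γp * n)

/-- Condition (SE): slow enough decay, with rate `γm < 0`. -/
def CondSE (μ : Measure (ℕ → A)) (γm : ℝ) : Prop :=
  γm < 0 ∧ ∀ᶠ n : ℕ in atTop, ∀ a : Fin n → A, 0 < μ (cyl a) → Real.exp (γm * n) ≤ wp μ a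

/-- Condition (KB): Kontoyiannis' bound on waiting times, with sequences `k`, `τ`. -/
def CondKB (μ : Measure (ℕ → A)) (k τ : ℕ → ℝ) : Prop :=
  (k =o[atTop] fun n => (n : ℝ)) ∧ (τ =o[atTop] fun n => (n : ℝ)) ∧
    ∀ (ℓ : ℕ) (a : Fin ℓ → A) (r : ℕ),
      (μ {x | (r : ℕ∞) ≤ W a x}).toReal ≤
        Real.exp (-(Real.exp (-k ℓ) * wp μ a * (⌊((r : ℝ) - 1) / ((ℓ : ℝ) + τ ℓ)⌋ : ℝ)))

/-- Length of the next word of the auxiliary parsing of `y_1^N` starting at position `p`: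
the shortest prefix of the remaining portion of `y_1^N` with measure at most `θ`, or the
whole remaining portion if there is no such prefix. -/
def auxLen (μ : Measure (ℕ → A)) (θ : ℝ) (N : ℕ) (y : ℕ → A) (p : ℕ) : ℕ :=
  if ∃ ℓ, 1 ≤ ℓ ∧ p + ℓ ≤ N ∧ wp μ (seg y p ℓ) ≤ θ then
    sInf {ℓ | 1 ≤ ℓ ∧ p + ℓ ≤ N ∧ wp μ (seg y p ℓ) ≤ θ}
  else N - p

/-- Starting position of the `j`-th (0-based) word of the auxiliary parsing. -/
def auxPos (μ : Measure (ℕ → A)) (θ : ℝ) (N : ℕ) (y : ℕ → A) : ℕ → ℕ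
  | 0 => 0
  | j + 1 => auxPos μ θ N y j + max 1 (auxLen μ θ N y (auxPos μ θ N y j))

/-- Length of the `j`-th (0-based) word of the auxiliary parsing. -/
def auxWordLen (μ : Measure (ℕ → A)) (θ : ℝ) (N : ℕ) (y : ℕ → A) (j : ℕ) : ℕ :=
  max 1 (auxLen μ θ N y (auxPos μ θ N y j))

/-- The number of words in the auxiliary parsing of `y_1^N`. -/
def auxCount (μ : Measure (ℕ → A)) (θ : ℝ) (N : ℕ) (y : ℕ → A) : ℕ :=
  sInf {c | N ≤ auxPos μ θ N y c}

/-- Length of the next word of the block parsing within a block ending at position `e`: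
the shortest prefix of the remaining portion of the block with measure at most `θ`;
`0` encodes that no such prefix exists (the rest of the block is the buffer). -/
def blkLen (μ : Measure (ℕ → A)) (θ : ℝ) (e : ℕ) (y : ℕ → A) (p : ℕ) : ℕ :=
  sInf {ℓ | 1 ≤ ℓ ∧ p + ℓ ≤ e ∧ wp μ (seg y p ℓ) ≤ θ}

/-- Starting position of the `i`-th (0-based) word of the block starting at `q`, ending at `e`. -/
def blkPos (μ : Measure (ℕ → A)) (θ : ℝ) (e : ℕ) (y : ℕ → A) (q : ℕ) : ℕ → ℕ
  | 0 => q
  | i + 1 => blkPos μ θ e y q i + blkLen μ θ e y (blkPos μ θ e y q i)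

/-- Number `d_s` of words in the block starting at `q` and ending at `e`. -/
def dCount (μ : Measure (ℕ → A)) (θ : ℝ) (e : ℕ) (y : ℕ → A) (q : ℕ) : ℕ :=
  sInf {i | blkLen μ θ e y (blkPos μ θ e y q i) = 0}

/-- The block starting at `q` and ending at `e` is good: its parsed words are pairwise
distinct. -/
def GoodBlock (μ : Measure (ℕ → A)) (θ : ℝ) (e : ℕ) (y : ℕ → A) (q : ℕ) : Prop :=
  ∀ i j : ℕ, i < dCount μ θ e y q → j < dCount μ θ e y q →
    blkLen μ θ e y (blkPos μ θ e y q i) = blkLen μ θ e y (blkPos μ θ e y q j) →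
    (∀ t < blkLen μ θ e y (blkPos μ θ e y q i),
      y (blkPos μ θ e y q i + t) = y (blkPos μ θ e y q j + t)) →
    i = j

end MeasureDefs

/-- The block length `⌊N^α⌋`. -/
def blockB (N : ℕ) (α : ℝ) : ℕ := ⌊(N : ℝ) ^ α⌋₊

/-- The number `M_N` of blocks. -/
def blockM (N : ℕ) (α : ℝ) : ℕ := (N + blockB N α - 1) / blockB N α

/-- The starting position of the `s`-th (0-based) block. -/
def blockStart (N : ℕ) (α : ℝ) (s : ℕ) : ℕ := s * blockB N α

/-- The end position of the `s`-th (0-based) block. -/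
def blockEnd (N : ℕ) (α : ℝ) (s : ℕ) : ℕ := min ((s + 1) * blockB N α) N

/-- `S_b(y_1^N)`: the set of bad blocks of the block auxiliary parsing (with threshold
`N^{-1-ε}`, word probabilities computed with `μ`). -/
def badSet {A : Type*} [MeasurableSpace A] (μ : Measure (ℕ → A)) (N : ℕ) (α ε : ℝ)
    (y : ℕ → A) : Set ℕ :=
  {s | s < blockM N α ∧
    ¬ GoodBlock μ ((N : ℝ) ^ (-1 - ε)) (blockEnd N α s) y (blockStart N α s)}

/-- `ℓ₋ = ln N / (-2 γ₋)`. -/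
def ellMinus (N : ℕ) (γm : ℝ) : ℝ := Real.log N / (-2 * γm)

/-- `ℓ₊ = 2 ln N / (-γ₊)`. -/
def ellPlus (N : ℕ) (γp : ℝ) : ℝ := 2 * Real.log N / (-γp)

/-- `d₊ = 2 N^α / ℓ₋`. -/
def dPlus (N : ℕ) (α γm : ℝ) : ℝ := 2 * (N : ℝ) ^ α / ellMinus N γm

section CrossEntropy

variable {A : Type*} [MeasurableSpace A] [Fintype A]

/-- The `n`-th cross-entropy average `-(1/n) ∑_{a ∈ 𝒜ⁿ} ℚ[a] ln ℙ[a]`, real-valued version. -/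
def hcSeq (μP μQ : Measure (ℕ → A)) (n : ℕ) : ℝ :=
  -(1 / (n : ℝ)) * ∑ a : Fin n → A, wp μQ a * Real.log (wp μP a)

/-- `-ln p` as an element of `[0, ∞]`, for `p ∈ [0, 1]`; equals `⊤` when `p = 0`. -/
def negLog (p : ℝ≥0∞) : ℝ≥0∞ := if p = 0 then ⊤ else ENNReal.ofReal (-Real.log p.toReal)

/-- The `n`-th cross-entropy average, `[0, ∞]`-valued version. -/
def hcSeqE (μP μQ : Measure (ℕ → A)) (n : ℕ) : ℝ≥0∞ :=
  (∑ a : Fin n → A, μQ (cyl a) * negLog (μP (cyl a))) / (n : ℝ≥0∞)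

end CrossEntropy

end ZM

namespace ZM

section Ergodic

variable {α : Type*}

/-- The maximum of the Birkhoff sums of `g` over at most `n` steps. -/
def maxBirkhoff (T : α → α) (g : α → ℝ) : ℕ → α → ℝ
  | 0 => fun _ => 0
  | n + 1 => fun x => max 0 (g x + maxBirkhoff T g n (T x))

theorem maxBirkhoff_nonneg (T : α → α) (g : α → ℝ) (n : ℕ) (x : α) :
    0 ≤ maxBirkhoff T g n x := by
  cases n with
  | zero => exact le_rfl
  | succ n => exact le_max_left _ _

theorem maxBirkhoff_le_succ (T : α → α) (g : α → ℝ) (n : ℕ) :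
    ∀ x, maxBirkhoff T g n x ≤ maxBirkhoff T g (n + 1) x := by
  induction n with
  | zero => exact fun x => maxBirkhoff_nonneg T g 1 x
  | succ n ih =>
    intro x
    exact max_le_max le_rfl (by linarith [ih (T x)])

theorem birkhoffSum_le_maxBirkhoff (T : α → α) (g : α → ℝ) (n : ℕ) :
    ∀ x, birkhoffSum T g n x ≤ maxBirkhoff T g n x := by
  induction n with
  | zero => intro x; simp [maxBirkhoff]
  | succ n ih =>
    intro x
    rw [birkhoffSum_succ']
    exact le_max_of_le_right (by linarith [ih (T x)])

variable [MeasurableSpace α] {μ : Measure α} {T : α → α} {g : α → ℝ}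

theorem measurable_maxBirkhoff (hT : Measurable T) (hg : Measurable g) (n : ℕ) :
    Measurable (maxBirkhoff T g n) := by
  induction n with
  | zero => exact measurable_const
  | succ n ih => exact measurable_const.max (hg.add (ih.comp hT))

theorem integrable_maxBirkhoff (hT : MeasurePreserving T μ μ) (hg : Integrable g μ) (n : ℕ) :
    Integrable (maxBirkhoff T g n) μ := by
  induction n with
  | zero => exact integrable_zero _ _ _
  | succ n ih =>
    exact (integrable_zero _ _ _).sup (hg.add (hT.integrable_comp_of_integrable ih))

/-- The maximal ergodic inequality. -/
theorem maximal_ergodic (hT : MeasurePreserving T μ μ) (hgm : Measurable g)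
    (hg : Integrable g μ) (n : ℕ) :
    0 ≤ ∫ x, {x | 0 < maxBirkhoff T g (n + 1) x}.indicator g x ∂μ := by
  have hM := integrable_maxBirkhoff hT hg
  have hms : MeasurableSet {x | 0 < maxBirkhoff T g (n + 1) x} :=
    measurableSet_lt measurable_const (measurable_maxBirkhoff hT.measurable hgm _)
  have h1 : ∫ x, (maxBirkhoff T g (n + 1) x - maxBirkhoff T g n (T x)) ∂μ
      ≤ ∫ x, {x | 0 < maxBirkhoff T g (n + 1) x}.indicator g x ∂μ := by
    refine integral_mono ((hM _).sub (hT.integrable_comp_of_integrable (hM n)))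
      (hg.indicator hms) fun x => ?_
    by_cases hx : 0 < maxBirkhoff T g (n + 1) x
    · rw [Set.indicator_of_mem (by exact hx)]
      have : maxBirkhoff T g (n + 1) x = g x + maxBirkhoff T g n (T x) := by
        rcases max_choice 0 (g x + maxBirkhoff T g n (T x)) with h | h
        · exact absurd (show maxBirkhoff T g (n + 1) x = 0 from h) hx.ne'
        · exact h
      linarith
    · rw [Set.indicator_of_notMem (by exact hx)]
      linarith [maxBirkhoff_nonneg T g n (T x)]
  have h2 : ∫ x, maxBirkhoff T g n (T x) ∂μ = ∫ x, maxBirkhoff T g n x ∂μ := by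
    have := integral_map (μ := μ) (φ := T) hT.measurable.aemeasurable
      (f := maxBirkhoff T g n) (by rw [hT.map_eq]; exact (hM n).aestronglyMeasurable)
    rw [← this, hT.map_eq]
  rw [integral_sub (hM _) (show Integrable (fun x => maxBirkhoff T g n (T x)) μ from
    hT.integrable_comp_of_integrable (hM n)), h2] at h1
  have h3 := integral_mono (hM n) (hM (n + 1)) (maxBirkhoff_le_succ T g n)
  linarith

theorem ae_birkhoffSum_bddAbove [IsProbabilityMeasure μ] (hT : Ergodic T μ) (hgm : Measurable g)
    (hg : Integrable g μ) (hneg : ∫ x, g x ∂μ < 0) :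
    ∀ᵐ x ∂μ, ∃ K : ℝ, ∀ n, birkhoffSum T g n x ≤ K := by
  set s : Set α := {x | ∀ K : ℕ, ∃ n, (K : ℝ) < maxBirkhoff T g n x} with hs
  have hsm : MeasurableSet s := by
    have : s = ⋂ K : ℕ, ⋃ n, {x | (K : ℝ) < maxBirkhoff T g n x} := by
      ext x; simp [hs]
    rw [this]
    exact .iInter fun K => .iUnion fun n =>
      measurableSet_lt measurable_const (measurable_maxBirkhoff hT.measurable hgm _)
  have hinv : T ⁻¹' s = s := by
    ext x
    simp only [hs, Set.mem_preimage, Set.mem_ofPred_eq]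
    constructor
    · intro h K
      obtain ⟨K', hK'⟩ := exists_nat_gt ((K : ℝ) - g x)
      obtain ⟨n, hn⟩ := h K'
      exact ⟨n + 1, lt_max_of_lt_right (by linarith)⟩
    · intro h K
      obtain ⟨K', hK'⟩ := exists_nat_gt (max 0 ((K : ℝ) + g x))
      obtain ⟨n, hn⟩ := h K'
      cases n with
      | zero =>
        have : (K' : ℝ) < 0 := hn
        have := (K'.cast_nonneg : (0 : ℝ) ≤ K')
        linarith
      | succ n =>
        refine ⟨n, ?_⟩
        rcases lt_max_iff.1 (show (K' : ℝ) < max 0 (g x + maxBirkhoff T g n (T x)) from hn)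
          with h0 | h0
        · have := (K'.cast_nonneg : (0 : ℝ) ≤ K')
          linarith
        · linarith [le_max_right 0 ((K : ℝ) + g x)]
  rcases hT.ae_mem_or_ae_notMem hsm hinv with h | h
  · exfalso
    have hlim : Tendsto (fun n : ℕ => ∫ x,
        {x | 0 < maxBirkhoff T g (n + 1) x}.indicator g x ∂μ) atTop (nhds (∫ x, g x ∂μ)) := by
      refine tendsto_integral_of_dominated_convergence (fun x => ‖g x‖) ?_ hg.norm ?_ ?_
      · intro n
        exact (hg.indicator (measurableSet_lt measurable_const
          (measurable_maxBirkhoff hT.measurable hgm _))).aestronglyMeasurable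
      · intro n
        exact ae_of_all _ fun x => norm_indicator_le_norm_self _ _
      · filter_upwards [h] with x hx
        obtain ⟨n, hn⟩ := hx 0
        refine tendsto_const_nhds.congr' ?_
        filter_upwards [eventually_ge_atTop n] with m hm
        rw [Set.indicator_of_mem]
        have hmono : Monotone fun n => maxBirkhoff T g n x :=
          monotone_nat_of_le_succ fun n => maxBirkhoff_le_succ T g n x
        have := hmono (show n ≤ m + 1 by omega)
        simp only [Nat.cast_zero] at hn
        exact hn.trans_le this
    have := ge_of_tendsto' hlim fun n => maximal_ergodic hT.toMeasurePreserving hgm hg n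
    linarith
  · filter_upwards [h] with x hx
    simp only [hs, Set.mem_ofPred_eq, not_forall, not_exists, not_lt] at hx
    obtain ⟨K, hK⟩ := hx
    exact ⟨K, fun n => (birkhoffSum_le_maxBirkhoff T g n x).trans (hK n)⟩

theorem ae_eventually_birkhoffSum_le [IsProbabilityMeasure μ] (hT : Ergodic T μ)
    (hgm : Measurable g) (hg : Integrable g μ) {ε : ℝ} (hε : 0 < ε) :
    ∀ᵐ x ∂μ, ∀ᶠ n : ℕ in atTop, birkhoffSum T g n x ≤ n * (∫ x, g x ∂μ + ε) := by
  have hint : Integrable (fun x => g x - (∫ x, g x ∂μ + ε / 2)) μ := hg.sub (integrable_const _)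
  have := ae_birkhoffSum_bddAbove hT (g := fun x => g x - (∫ x, g x ∂μ + ε / 2))
    (hgm.sub_const _) hint (by
      rw [integral_sub hg (integrable_const _)]
      simp
      linarith)
  filter_upwards [this] with x ⟨K, hK⟩
  have h1 : ∀ᶠ n : ℕ in atTop, K / (ε / 2) ≤ n :=
    tendsto_natCast_atTop_atTop.eventually_ge_atTop _
  filter_upwards [h1] with n hn
  have h2 := hK n
  rw [div_le_iff₀ (by linarith)] at hn
  have h3 : birkhoffSum T (fun x => g x - (∫ x, g x ∂μ + ε / 2)) n x
      = birkhoffSum T g n x - n * (∫ x, g x ∂μ + ε / 2) := by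
    simp [birkhoffSum, Finset.sum_sub_distrib, mul_add]
  rw [h3] at h2
  nlinarith

/-- The pointwise ergodic theorem for ergodic probability measures. -/
theorem ae_tendsto_birkhoffSum_div [IsProbabilityMeasure μ] (hT : Ergodic T μ)
    (hg : Integrable g μ) :
    ∀ᵐ x ∂μ, Tendsto (fun n : ℕ => birkhoffSum T g n x / n) atTop (nhds (∫ x, g x ∂μ)) := by
  wlog hgm : Measurable g generalizing g
  · obtain ⟨f, hfm, hfg⟩ := hg.aestronglyMeasurable
    have h1 := this (hg.congr hfg) hfm.measurable
    have h2 : ∀ᵐ x ∂μ, ∀ n : ℕ, g (T^[n] x) = f (T^[n] x) :=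
      ae_all_iff.2 fun n =>
        (hT.toMeasurePreserving.iterate n).quasiMeasurePreserving.ae hfg
    filter_upwards [h1, h2] with x hx1 hx2
    rw [integral_congr_ae hfg]
    convert hx1 using 3 with n
    exact Finset.sum_congr rfl fun i _ => hx2 i
  have h1 : ∀ᵐ x ∂μ, ∀ m : ℕ, ∀ᶠ n : ℕ in atTop,
      birkhoffSum T g n x ≤ n * (∫ x, g x ∂μ + 1 / ((m : ℝ) + 1)) :=
    ae_all_iff.2 fun m => ae_eventually_birkhoffSum_le hT hgm hg (by positivity)
  have h2 : ∀ᵐ x ∂μ, ∀ m : ℕ, ∀ᶠ n : ℕ in atTop,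
      birkhoffSum T (-g) n x ≤ n * (∫ x, (-g) x ∂μ + 1 / ((m : ℝ) + 1)) :=
    ae_all_iff.2 fun m => ae_eventually_birkhoffSum_le hT hgm.neg hg.neg (by positivity)
  filter_upwards [h1, h2] with x hx1 hx2
  rw [Metric.tendsto_atTop']
  intro ε hε
  obtain ⟨m, hm⟩ := exists_nat_one_div_lt hε
  obtain ⟨N, hN⟩ := eventually_atTop.1 ((hx1 m).and (hx2 m))
  refine ⟨N, fun n hn => ?_⟩
  obtain ⟨ha, hb⟩ := hN n hn.le
  have hn0 : (0 : ℝ) < n := by exact_mod_cast (by omega : 0 < n)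
  have hneg : birkhoffSum T (-g) n x = -birkhoffSum T g n x := by simp [birkhoffSum]
  have hneg' : ∫ x, (-g) x ∂μ = -∫ x, g x ∂μ := by simp [integral_neg]
  rw [hneg, hneg'] at hb
  rw [Real.dist_eq, abs_lt]
  constructor
  · rw [lt_sub_iff_add_lt, lt_div_iff₀ hn0]
    nlinarith
  · rw [sub_lt_iff_lt_add, div_lt_iff₀ hn0]
    nlinarith

end Ergodic

section Parsing

variable {A : Type*} {N : ℕ} {x y : ℕ → A}

theorem appears_seg_mono {p l L : ℕ} (hl : l ≤ L) (h : appears N x (seg y p L)) :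
    appears N x (seg y p l) := by
  obtain ⟨r, hr, hm⟩ := h
  exact ⟨r, by omega, fun i => hm ⟨i, by omega⟩⟩

theorem zmLen_pos (p : ℕ) : 1 ≤ zmLen N x y p := le_max_left _ _

theorem bddAbove_zmLen (p : ℕ) : BddAbove {ℓ | p + ℓ ≤ N ∧ appears N x (seg y p ℓ)} :=
  ⟨N, fun _ h => by have := h.1; omega⟩

theorem sSup_zmLen_mem {p : ℕ} (hp : p ≤ N) :
    sSup {ℓ | p + ℓ ≤ N ∧ appears N x (seg y p ℓ)} ∈
      {ℓ | p + ℓ ≤ N ∧ appears N x (seg y p ℓ)} :=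
  Nat.sSup_mem ⟨0, by simpa using hp, 0, by omega, fun i => i.elim0⟩ (bddAbove_zmLen p)

theorem add_zmLen_le {p : ℕ} (hp : p < N) : p + zmLen N x y p ≤ N := by
  have h := (sSup_zmLen_mem (x := x) (y := y) hp.le).1
  unfold zmLen
  omega

theorem appears_zmLen_or {p : ℕ} (hp : p ≤ N) :
    appears N x (seg y p (zmLen N x y p)) ∨ zmLen N x y p = 1 := by
  have h := (sSup_zmLen_mem (x := x) (y := y) hp).2
  unfold zmLen
  rcases max_choice 1 (sSup {ℓ | p + ℓ ≤ N ∧ appears N x (seg y p ℓ)}) with h' | h'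
  · exact .inr h'
  · exact .inl (by rwa [h'])

theorem not_appears_of_zmLen_lt {p L : ℕ} (hp : p + zmLen N x y p < N)
    (hL : zmLen N x y p < L) : ¬ appears N x (seg y p L) := by
  intro h
  have h1 : zmLen N x y p + 1 ≤ sSup {ℓ | p + ℓ ≤ N ∧ appears N x (seg y p ℓ)} :=
    le_csSup (bddAbove_zmLen p) ⟨by omega, appears_seg_mono hL h⟩
  have h2 : sSup {ℓ | p + ℓ ≤ N ∧ appears N x (seg y p ℓ)} ≤ zmLen N x y p := le_max_right _ _
  omega

theorem zmPos_strictMono : StrictMono (zmPos N x y) :=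
  strictMono_nat_of_lt_succ fun j => by
    have := zmLen_pos (N := N) (x := x) (y := y) (zmPos N x y j)
    simp only [zmPos]
    omega

theorem le_zmPos_cN : N ≤ zmPos N x y (cN N x y) :=
  Nat.sInf_mem (s := {c | N ≤ zmPos N x y c}) ⟨N, zmPos_strictMono.id_le N⟩

theorem zmPos_lt {j : ℕ} (hj : j < cN N x y) : zmPos N x y j < N :=
  not_le.1 (Nat.notMem_of_lt_sInf (s := {c | N ≤ zmPos N x y c}) hj)

theorem zmPos_cN : zmPos N x y (cN N x y) = N := by
  refine le_antisymm ?_ le_zmPos_cN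
  rcases h : cN N x y with _ | c
  · exact Nat.zero_le _
  · exact add_zmLen_le (zmPos_lt (by omega))

theorem zmPos_eq_sum (c : ℕ) :
    zmPos N x y c = ∑ j ∈ Finset.range c, zmLen N x y (zmPos N x y j) := by
  induction c with
  | zero => rfl
  | succ c ih => rw [Finset.sum_range_succ, ← ih, zmPos]

theorem exists_zmPos_le_lt {q : ℕ} (hq : q < N) :
    ∃ j < cN N x y, zmPos N x y j ≤ q ∧ q < zmPos N x y (j + 1) := by
  have hex : ∃ c, q < zmPos N x y c := ⟨cN N x y, hq.trans_le le_zmPos_cN⟩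
  obtain ⟨j, hj⟩ : ∃ j, Nat.find hex = j + 1 := by
    refine Nat.exists_eq_succ_of_ne_zero fun h => ?_
    have := Nat.find_spec hex
    rw [h] at this
    exact absurd this (Nat.not_lt_zero _)
  refine ⟨j, ?_, ?_, ?_⟩
  · have := Nat.find_min' hex (hq.trans_le le_zmPos_cN)
    omega
  · exact not_lt.1 (Nat.find_min hex (by omega))
  · rw [← hj]; exact Nat.find_spec hex

/-- Words absent from `x` can occur in `y` only near the ends of the parsed words. -/
theorem card_occurrences_le {n : ℕ} (hn : 1 ≤ n) {U : Set (Fin n → A)}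
    (hx : ∀ r, seg x r n ∉ U) :
    ((Finset.range N).filter fun q => seg y q n ∈ U).card ≤ n * cN N x y := by
  have hsub : ((Finset.range N).filter fun q => seg y q n ∈ U) ⊆
      (Finset.range (cN N x y)).biUnion fun j =>
        Finset.Ico (zmPos N x y (j + 1) - n) (zmPos N x y (j + 1)) := by
    intro q hq
    simp only [Finset.mem_filter, Finset.mem_range] at hq
    obtain ⟨j, hj, h1, h2⟩ := exists_zmPos_le_lt (x := x) (y := y) hq.1
    simp only [Finset.mem_biUnion, Finset.mem_range, Finset.mem_Ico]
    refine ⟨j, hj, ?_, h2⟩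
    by_contra! hlt
    have hpos : zmPos N x y (j + 1) = zmPos N x y j + zmLen N x y (zmPos N x y j) := rfl
    rcases appears_zmLen_or (x := x) (y := y) (zmPos_lt hj).le with h | h
    · obtain ⟨r, hr, hm⟩ := h
      refine hx (r + (q - zmPos N x y j)) ?_
      convert hq.2 using 1
      funext i
      have := hm ⟨q - zmPos N x y j + i, by omega⟩
      simp only [seg] at this ⊢
      rw [add_assoc, this]
      congr 1
      omega
    · omega
  refine (Finset.card_le_card hsub).trans (Finset.card_biUnion_le.trans ?_)
  refine (Finset.sum_le_card_nsmul _ _ n fun j _ => ?_).trans ?_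
  · simp only [Nat.card_Ico]; omega
  · simp [mul_comm]

end Parsing

section AlmostAdditive

variable {F : ℕ → ℕ → ℝ} {k : ℕ → ℝ}

theorem exists_sublinear_bound (hk : k =o[atTop] fun n => (n : ℝ)) {δ : ℝ} (hδ : 0 < δ) :
    ∃ C : ℝ, 0 ≤ C ∧ ∀ n, k n ≤ δ * n + C := by
  obtain ⟨M, hM⟩ := eventually_atTop.1 (hk.bound hδ)
  refine ⟨∑ i ∈ Finset.range M, |k i|, Finset.sum_nonneg fun _ _ => abs_nonneg _, fun n => ?_⟩
  by_cases hn : M ≤ n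
  · have h1 := hM n hn
    have h2 : 0 ≤ ∑ i ∈ Finset.range M, |k i| := Finset.sum_nonneg fun _ _ => abs_nonneg _
    rw [Real.norm_eq_abs, Real.norm_eq_abs, abs_of_nonneg (n.cast_nonneg : (0 : ℝ) ≤ n)] at h1
    linarith [le_abs_self (k n)]
  · have h1 : |k n| ≤ ∑ i ∈ Finset.range M, |k i| :=
      Finset.single_le_sum (f := fun i => |k i|) (fun _ _ => abs_nonneg _)
        (Finset.mem_range.2 (not_le.1 hn))
    have h2 : 0 ≤ δ * n := by positivity
    linarith [le_abs_self (k n)]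

theorem abs_sub_sum_le (hF0 : ∀ p, F p 0 = 0)
    (hF : ∀ p n m, |F p (n + m) - F p n - F (p + n) m| ≤ k n) (c : ℕ) :
    ∀ (l : ℕ → ℕ) (q : ℕ), |F q (∑ j ∈ Finset.range c, l j) -
      ∑ j ∈ Finset.range c, F (q + ∑ i ∈ Finset.range j, l i) (l j)|
        ≤ ∑ j ∈ Finset.range c, k (l j) := by
  induction c with
  | zero => intro l q; simp [hF0]
  | succ c ih =>
    intro l q
    have h1 := ih (fun j => l (j + 1)) (q + l 0)
    have h2 := hF q (l 0) (∑ j ∈ Finset.range c, l (j + 1))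
    have h3 : ∀ j, q + ∑ i ∈ Finset.range (j + 1), l i =
        q + l 0 + ∑ i ∈ Finset.range j, l (i + 1) := fun j => by
      rw [Finset.sum_range_succ']; ring
    rw [Finset.sum_range_succ' l, Finset.sum_range_succ' (fun j => F _ (l j)),
      Finset.sum_range_succ' (fun j => k (l j)), add_comm (∑ j ∈ Finset.range c, l (j + 1))]
    simp only [h3, Finset.range_zero, Finset.sum_empty, add_zero]
    rw [abs_le] at h1 h2 ⊢
    constructor <;> linarith [h1.1, h1.2, h2.1, h2.2]

theorem le_mul_of_almost_additive {C : ℝ} (hF0 : ∀ p, F p 0 = 0)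
    (hF : ∀ p n m, |F p (n + m) - F p n - F (p + n) m| ≤ k n) (hC : ∀ p, F p 1 ≤ C) (n : ℕ) :
    ∀ p, F p n ≤ n * (C + k 1) := by
  induction n with
  | zero => intro p; simp [hF0]
  | succ n ih =>
    intro p
    have h1 := hF p 1 n
    rw [abs_le] at h1
    rw [add_comm n 1]
    push_cast
    linarith [ih (p + 1), hC p]

/-- Comparison of an almost additive cocycle with the Birkhoff sums of its `m`-th term. -/
theorem exists_abs_mul_sub_sum_le {C : ℝ} (hF0 : ∀ p, F p 0 = 0) (hFnn : ∀ p n, 0 ≤ F p n)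
    (hF : ∀ p n m, |F p (n + m) - F p n - F (p + n) m| ≤ k n) (hC : ∀ p, F p 1 ≤ C)
    (hkm : Monotone k) (m : ℕ) :
    ∃ K : ℝ, ∀ n, |m * F 0 n - ∑ j ∈ Finset.range n, F j m| ≤ n * k m + K := by
  have hk0 : 0 ≤ k 0 := (abs_nonneg _).trans (hF 0 0 0)
  have hkm0 : 0 ≤ k m := hk0.trans (hkm (Nat.zero_le _))
  have hk1 : 0 ≤ k 1 := hk0.trans (hkm (Nat.zero_le _))
  have hC0 : 0 ≤ C := (hFnn 0 1).trans (hC 0)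
  have hup := le_mul_of_almost_additive hF0 hF hC
  have hup' : ∀ p j, j ≤ m → F p j ≤ m * (C + k 1) := fun p j hj =>
    (hup j p).trans (by gcongr)
  set B : ℝ := m * (C + k 1) with hB
  have hB0 : 0 ≤ B := by positivity
  have hmB : 0 ≤ (m : ℝ) * B := by positivity
  refine ⟨m * (k m + 3 * B), fun n => ?_⟩
  by_cases hn : m ≤ n
  · obtain ⟨L, rfl⟩ := Nat.exists_eq_add_of_le' hn
    -- `G j = F j (L + m - j)` telescopes with step `m`
    have h1 : |∑ j ∈ Finset.range L, (F j (L + m - j) - F (j + m) (L + m - (j + m))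
        - F j m)| ≤ ∑ j ∈ Finset.range L, k m := by
      refine (Finset.abs_sum_le_sum_abs _ _).trans (Finset.sum_le_sum fun j hj => ?_)
      rw [Finset.mem_range] at hj
      have := hF j m (L - j)
      rw [show m + (L - j) = L + m - j by omega] at this
      rw [show L + m - (j + m) = L - j by omega]
      rwa [sub_right_comm] at this
    have h2 : ∑ j ∈ Finset.range L, F j (L + m - j) -
          ∑ j ∈ Finset.range L, F (j + m) (L + m - (j + m)) =
        ∑ j ∈ Finset.range m, F j (L + m - j) -
          ∑ j ∈ Finset.range m, F (L + j) (L + m - (L + j)) := by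
      have e1 := Finset.sum_range_add (fun j => F j (L + m - j)) L m
      have e2 := Finset.sum_range_add (fun j => F j (L + m - j)) m L
      rw [add_comm m L] at e2
      simp only [add_comm m] at e2
      linarith
    have h3 : |m * F 0 (L + m) - ∑ j ∈ Finset.range m, F j (L + m - j)| ≤ m * (k m + B) := by
      have : (m : ℝ) * F 0 (L + m) - ∑ j ∈ Finset.range m, F j (L + m - j) =
          ∑ j ∈ Finset.range m, (F 0 (L + m) - F j (L + m - j)) := by
        simp [Finset.sum_sub_distrib]
      rw [this]
      refine (Finset.abs_sum_le_sum_abs _ _).trans ((Finset.sum_le_card_nsmul _ _ (k m + B)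
        fun j hj => ?_).trans (by simp [mul_add]))
      rw [Finset.mem_range] at hj
      have e := hF 0 j (L + m - j)
      rw [show j + (L + m - j) = L + m by omega, zero_add] at e
      have e1 := hup' 0 j hj.le
      have e2 := hFnn 0 j
      have e3 := hkm hj.le
      rw [abs_le] at e ⊢
      constructor <;> linarith
    have h4 : |∑ j ∈ Finset.range m, F (L + j) (L + m - (L + j))| ≤ m * B := by
      refine (Finset.abs_sum_le_sum_abs _ _).trans ((Finset.sum_le_card_nsmul _ _ B
        fun j hj => ?_).trans (by simp))
      rw [abs_of_nonneg (hFnn _ _)]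
      exact hup' _ _ (by omega)
    have h5 : |∑ j ∈ Finset.range m, F (L + j) m| ≤ m * B := by
      refine (Finset.abs_sum_le_sum_abs _ _).trans ((Finset.sum_le_card_nsmul _ _ B
        fun j hj => ?_).trans (by simp))
      rw [abs_of_nonneg (hFnn _ _)]
      exact hup' _ _ le_rfl
    rw [Finset.sum_sub_distrib, Finset.sum_sub_distrib, h2, Finset.sum_const,
      Finset.card_range, nsmul_eq_mul] at h1
    rw [Finset.sum_range_add (fun j => F j m) L m]
    push_cast
    rw [abs_le] at h1 h3 h4 h5 ⊢
    constructor <;> nlinarith [mul_nonneg (m.cast_nonneg : (0 : ℝ) ≤ m) hkm0]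
  · have h1 : |∑ j ∈ Finset.range n, F j m| ≤ m * B := by
      refine (Finset.abs_sum_le_sum_abs _ _).trans ((Finset.sum_le_card_nsmul _ _ B
        fun j hj => ?_).trans ?_)
      · rw [abs_of_nonneg (hFnn _ _)]
        exact hup' _ _ le_rfl
      · rw [Finset.card_range, nsmul_eq_mul]
        gcongr
        omega
    have h2 : m * F 0 n ≤ m * B := by
      gcongr
      exact hup' _ _ (by omega)
    have h3 : 0 ≤ m * F 0 n := mul_nonneg (Nat.cast_nonneg _) (hFnn _ _)
    have h4 : 0 ≤ (n : ℝ) * k m := by positivity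
    have h5 : 0 ≤ (m : ℝ) * k m := by positivity
    rw [abs_le] at h1 ⊢
    constructor <;> nlinarith

end AlmostAdditive

section ParsingBounds

variable {A : Type*} {N : ℕ} {x y : ℕ → A} {F : ℕ → ℕ → ℝ} {k : ℕ → ℝ}

theorem abs_sub_sum_zm_le (hF0 : ∀ p, F p 0 = 0)
    (hF : ∀ p n m, |F p (n + m) - F p n - F (p + n) m| ≤ k n) {δ D : ℝ}
    (hk : ∀ n, k n ≤ δ * n + D) :
    |F 0 N - ∑ j ∈ Finset.range (cN N x y), F (zmPos N x y j) (zmLen N x y (zmPos N x y j))|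
        ≤ ∑ j ∈ Finset.range (cN N x y), k (zmLen N x y (zmPos N x y j)) ∧
      ∑ j ∈ Finset.range (cN N x y), k (zmLen N x y (zmPos N x y j)) ≤
        δ * N + cN N x y * D := by
  have h1 := abs_sub_sum_le hF0 hF (cN N x y) (fun j => zmLen N x y (zmPos N x y j)) 0
  have h2 : ∑ j ∈ Finset.range (cN N x y), zmLen N x y (zmPos N x y j) = N := by
    rw [← zmPos_eq_sum, zmPos_cN]
  simp only [← zmPos_eq_sum, zmPos_cN, zero_add] at h1
  refine ⟨h1, (Finset.sum_le_sum fun j _ => hk _).trans (le_of_eq ?_)⟩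
  have h2' : ∑ j ∈ Finset.range (cN N x y), (zmLen N x y (zmPos N x y j) : ℝ) = N := by
    exact_mod_cast h2
  rw [Finset.sum_add_distrib, ← Finset.mul_sum, h2']
  simp

theorem cN_mul_le {C : ℝ} (hF0 : ∀ p, F p 0 = 0) (hFnn : ∀ p n, 0 ≤ F p n)
    (hF : ∀ p n m, |F p (n + m) - F p n - F (p + n) m| ≤ k n) (hC : ∀ p, F p 1 ≤ C)
    {δ D : ℝ} (hk : ∀ n, k n ≤ δ * n + D) (hk0 : ∀ n, 0 ≤ k n) {l₁ : ℕ} {t : ℝ}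
    (ht : 0 ≤ t) (hA : ∀ p < N, ∀ l ≥ l₁, F p l ≤ t → appears N x (seg y p l)) :
    cN N x y * t ≤ F 0 N + t + 2 * δ * N + cN N x y * (2 * D + (l₁ + 1) * (C + k 1)) := by
  obtain ⟨h1, h2⟩ := abs_sub_sum_zm_le (N := N) (x := x) (y := y) hF0 hF hk
  have hC0 : 0 ≤ C := (hFnn 0 1).trans (hC 0)
  have hCk : 0 ≤ C + k 1 := add_nonneg hC0 (hk0 1)
  set K : ℝ := (l₁ + 1) * (C + k 1) with hK
  have hK0 : 0 ≤ K := by positivity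
  have hstep : ∀ j, j + 1 < cN N x y →
      t ≤ F (zmPos N x y j) (zmLen N x y (zmPos N x y j)) +
        k (zmLen N x y (zmPos N x y j)) + K := by
    intro j hj
    have hp := zmPos_lt hj
    set p := zmPos N x y j with hpdef
    have hp1 : zmPos N x y (j + 1) = p + zmLen N x y p := rfl
    rw [hp1] at hp
    set l := zmLen N x y p with hl
    have hna : ¬ appears N x (seg y p (max (l + 1) l₁)) :=
      not_appears_of_zmLen_lt hp (lt_of_lt_of_le (Nat.lt_succ_self _) (le_max_left _ _))
    have hlt : t < F p (max (l + 1) l₁) := by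
      by_contra! h
      exact hna (hA p (by omega) _ (le_max_right _ _) h)
    have e1 := hF p l (max (l + 1) l₁ - l)
    rw [show l + (max (l + 1) l₁ - l) = max (l + 1) l₁ by omega] at e1
    have e2 : F (p + l) (max (l + 1) l₁ - l) ≤ K := by
      refine (le_mul_of_almost_additive hF0 hF hC _ _).trans ?_
      rw [hK]
      gcongr
      have : max (l + 1) l₁ - l ≤ l₁ + 1 := by omega
      exact_mod_cast this
    rw [abs_le] at e1
    linarith [e1.2]
  have hsum : cN N x y * t ≤ ∑ j ∈ Finset.range (cN N x y),
      (F (zmPos N x y j) (zmLen N x y (zmPos N x y j)) +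
        k (zmLen N x y (zmPos N x y j)) + K) + t := by
    rcases hc : cN N x y with _ | c
    · simpa using ht
    · rw [Finset.sum_range_succ]
      have e1 : ∑ j ∈ Finset.range c, t ≤ ∑ j ∈ Finset.range c,
          (F (zmPos N x y j) (zmLen N x y (zmPos N x y j)) +
            k (zmLen N x y (zmPos N x y j)) + K) :=
        Finset.sum_le_sum fun j hj => hstep j (by rw [Finset.mem_range] at hj; omega)
      have e2 := hFnn (zmPos N x y c) (zmLen N x y (zmPos N x y c))
      have e3 := hk0 (zmLen N x y (zmPos N x y c))
      simp only [Finset.sum_const, Finset.card_range, nsmul_eq_mul] at e1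
      push_cast
      linarith
  rw [Finset.sum_add_distrib, Finset.sum_add_distrib] at hsum
  simp only [Finset.sum_const, Finset.card_range, nsmul_eq_mul] at hsum
  rw [abs_le] at h1
  linarith [h1.1]

/-- The number of positions of `y_1^N` where some word with `F`-value at least `s` starts and
appears in `x_1^N`. -/
def longMatchCount (N : ℕ) (x y : ℕ → A) (F : ℕ → ℕ → ℝ) (s : ℝ) : ℕ :=
  ((Finset.range N).filter fun p => ∃ l, s ≤ F p l ∧ appears N x (seg y p l)).card

theorem le_cN_mul {C : ℝ} (hF0 : ∀ p, F p 0 = 0)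
    (hF : ∀ p n m, |F p (n + m) - F p n - F (p + n) m| ≤ k n) (hC : ∀ p, F p 1 ≤ C)
    {δ D : ℝ} (hk : ∀ n, k n ≤ δ * n + D) {s T : ℝ} (hCs : C ≤ s) (hs : 0 ≤ s) (hT : 0 ≤ T)
    (hB : ∀ p < N, ∀ l, appears N x (seg y p l) → F p l ≤ T) :
    F 0 N ≤ cN N x y * (s + D) + longMatchCount N x y F s * T + δ * N := by
  obtain ⟨h1, h2⟩ := abs_sub_sum_zm_le (N := N) (x := x) (y := y) hF0 hF hk
  set P : ℕ → Prop := fun p => ∃ l, s ≤ F p l ∧ appears N x (seg y p l) with hP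
  have hstep : ∀ j ∈ Finset.range (cN N x y),
      F (zmPos N x y j) (zmLen N x y (zmPos N x y j)) ≤
        s + if P (zmPos N x y j) then T else 0 := by
    intro j hj
    have hp := zmPos_lt (Finset.mem_range.1 hj)
    rcases le_total (F (zmPos N x y j) (zmLen N x y (zmPos N x y j))) s with h | h
    · split_ifs <;> linarith
    · rcases appears_zmLen_or (x := x) (y := y) hp.le with ha | h1
      · rw [if_pos ⟨_, h, ha⟩]
        linarith [hB _ hp _ ha]
      · rw [h1]
        have := hC (zmPos N x y j)
        split_ifs <;> linarith
  have hsum := Finset.sum_le_sum hstep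
  rw [Finset.sum_add_distrib, ← Finset.sum_filter] at hsum
  simp only [Finset.sum_const, Finset.card_range, nsmul_eq_mul] at hsum
  have hcard : ((Finset.range (cN N x y)).filter fun j => P (zmPos N x y j)).card ≤
      longMatchCount N x y F s := by
    refine Finset.card_le_card_of_injOn (zmPos N x y) (fun j hj => ?_)
      (zmPos_strictMono.injective.injOn)
    simp only [Finset.coe_filter, Set.mem_ofPred_eq, Finset.mem_range] at hj ⊢
    exact ⟨zmPos_lt hj.1, hj.2⟩
  have hcard' : (((Finset.range (cN N x y)).filter fun j => P (zmPos N x y j)).card : ℝ) * T ≤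
      longMatchCount N x y F s * T := by
    gcongr
  rw [abs_le] at h1
  linarith [h1.2]

theorem tendsto_of_eventually_bounds {q : ℕ → ℝ} {h : ℝ}
    (hu : ∀ m : ℕ, ∀ᶠ N in atTop,
      q N * (1 - 2 * (1 / ((m : ℝ) + 3))) ≤ h + 4 * (1 / ((m : ℝ) + 3)))
    (hl : ∀ m : ℕ, ∀ᶠ N in atTop,
      h - 4 * (1 / ((m : ℝ) + 3)) ≤ q N * (1 + 2 * (1 / ((m : ℝ) + 3)))) :
    Tendsto q atTop (nhds h) := by
  have he : Tendsto (fun m : ℕ => 1 / ((m : ℝ) + 3)) atTop (nhds 0) := by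
    have := (tendsto_const_nhds (x := (1 : ℝ))).div_atTop
      (tendsto_atTop_add_const_right atTop (3 : ℝ) (tendsto_natCast_atTop_atTop (R := ℝ)))
    exact this
  rw [tendsto_order]
  constructor
  · intro a ha
    have h1 : Tendsto (fun m : ℕ => (h - 4 * (1 / ((m : ℝ) + 3))) / (1 + 2 * (1 / ((m : ℝ) + 3))))
        atTop (nhds ((h - 4 * 0) / (1 + 2 * 0))) :=
      (tendsto_const_nhds.sub (he.const_mul 4)).div
        (tendsto_const_nhds.add (he.const_mul 2)) (by norm_num)
    simp only [mul_zero, sub_zero, add_zero, div_one] at h1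
    obtain ⟨m, hm⟩ := (h1.eventually_const_lt ha).exists
    have hp : 0 < 1 + 2 * (1 / ((m : ℝ) + 3)) := by positivity
    filter_upwards [hl m] with N hN
    exact hm.trans_le ((div_le_iff₀ hp).2 hN)
  · intro a ha
    have h1 : Tendsto (fun m : ℕ => (h + 4 * (1 / ((m : ℝ) + 3))) / (1 - 2 * (1 / ((m : ℝ) + 3))))
        atTop (nhds ((h + 4 * 0) / (1 - 2 * 0))) :=
      (tendsto_const_nhds.add (he.const_mul 4)).div
        (tendsto_const_nhds.sub (he.const_mul 2)) (by norm_num)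
    simp only [mul_zero, sub_zero, add_zero, div_one] at h1
    obtain ⟨m, hm⟩ := (h1.eventually_lt_const ha).exists
    have hp : 0 < 1 - 2 * (1 / ((m : ℝ) + 3)) := by
      rw [sub_pos, mul_one_div, div_lt_one (by positivity)]
      linarith [(m.cast_nonneg : (0 : ℝ) ≤ m)]
    filter_upwards [hu m] with N hN
    exact ((le_div_iff₀ hp).2 hN).trans_lt hm

theorem tendsto_log_natCast : Tendsto (fun N : ℕ => Real.log N) atTop atTop :=
  Real.tendsto_log_atTop.comp tendsto_natCast_atTop_atTop

theorem tendsto_log_div_natCast : Tendsto (fun N : ℕ => Real.log N / N) atTop (nhds 0) :=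
  Real.isLittleO_log_id_atTop.tendsto_div_nhds_zero.comp tendsto_natCast_atTop_atTop

/-- The deterministic core: almost additivity along `y` and the two matching estimates give
convergence of the Ziv–Merhav estimator. -/
theorem tendsto_ZMest_of_matching {C h : ℝ} (hF0 : ∀ p, F p 0 = 0)
    (hFnn : ∀ p n, 0 ≤ F p n)
    (hF : ∀ p n m, |F p (n + m) - F p n - F (p + n) m| ≤ k n) (hC : ∀ p, F p 1 ≤ C)
    (hkm : Monotone k) (hko : k =o[atTop] fun n => (n : ℝ))
    (hlim : Tendsto (fun N : ℕ => F 0 N / N) atTop (nhds h))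
    (hA : ∀ m : ℕ, ∃ l₁ : ℕ, ∀ᶠ N : ℕ in atTop, ∀ p < N, ∀ l ≥ l₁,
      F p l ≤ (1 - 1 / ((m : ℝ) + 3)) * Real.log N → appears N x (seg y p l))
    (hB : ∀ᶠ N : ℕ in atTop, ∀ p < N, ∀ l, appears N x (seg y p l) → F p l ≤ 4 * Real.log N)
    (hG : ∀ m : ℕ, Tendsto (fun N : ℕ =>
      longMatchCount N x y F ((1 + 1 / ((m : ℝ) + 3)) * Real.log N) * Real.log N / N)
        atTop (nhds 0)) :
    Tendsto (fun N => ZMest N x y) atTop (nhds h) := by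
  have hk0 : ∀ n, 0 ≤ k n := fun n =>
    ((abs_nonneg _).trans (hF 0 0 0)).trans (hkm (Nat.zero_le n))
  refine tendsto_of_eventually_bounds (fun m => ?_) fun m => ?_
  · set ε : ℝ := 1 / ((m : ℝ) + 3) with hε
    have hε0 : 0 < ε := by positivity
    have hε1 : ε < 1 := by
      rw [hε, div_lt_one (by positivity)]
      linarith [(m.cast_nonneg : (0 : ℝ) ≤ m)]
    obtain ⟨D, hD0, hD⟩ := exists_sublinear_bound hko hε0
    obtain ⟨l₁, hl₁⟩ := hA m
    filter_upwards [hl₁, hlim.eventually_lt_const (show h < h + ε by linarith),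
      tendsto_log_div_natCast.eventually_lt_const hε0,
      tendsto_log_natCast.eventually_ge_atTop ((2 * D + (l₁ + 1) * (C + k 1)) / ε),
      tendsto_log_natCast.eventually_gt_atTop 0, eventually_gt_atTop 0] with N h1 h2 h3 h4 h5 h6
    have hN : (0 : ℝ) < N := by exact_mod_cast h6
    have h7 := cN_mul_le hF0 hFnn hF hC hD hk0
      (mul_nonneg (sub_nonneg.2 hε1.le) h5.le) h1
    rw [div_le_iff₀ hε0] at h4
    rw [div_lt_iff₀ hN] at h2 h3
    have h8 : (cN N x y : ℝ) * (2 * D + (l₁ + 1) * (C + k 1)) ≤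
        cN N x y * (Real.log N * ε) := by gcongr
    have h9 : (1 - ε) * Real.log N ≤ Real.log N := by nlinarith
    rw [ZMest, div_mul_eq_mul_div, div_le_iff₀ hN]
    nlinarith
  · set ε : ℝ := 1 / ((m : ℝ) + 3) with hε
    have hε0 : 0 < ε := by positivity
    obtain ⟨D, hD0, hD⟩ := exists_sublinear_bound hko hε0
    filter_upwards [hB, hlim.eventually_const_lt (show h - ε < h by linarith),
      (hG m).eventually_lt_const (show 0 < ε / 4 by positivity),
      tendsto_log_natCast.eventually_ge_atTop (D / ε),
      tendsto_log_natCast.eventually_ge_atTop C,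
      tendsto_log_natCast.eventually_gt_atTop 0, eventually_gt_atTop 0]
      with N h1 h2 h3 h4 h4' h5 h6
    have hN : (0 : ℝ) < N := by exact_mod_cast h6
    have hs : Real.log N ≤ (1 + ε) * Real.log N := by nlinarith
    have h7 := le_cN_mul hF0 hF hC hD (h4'.trans hs) (h5.le.trans hs)
      (show 0 ≤ 4 * Real.log N by positivity) h1
    rw [div_le_iff₀ hε0] at h4
    rw [lt_div_iff₀ hN] at h2
    rw [div_lt_iff₀ hN] at h3
    have h8 : (cN N x y : ℝ) * D ≤ cN N x y * (Real.log N * ε) := by gcongr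
    rw [ZMest, div_mul_eq_mul_div, le_div_iff₀ hN]
    nlinarith

end ParsingBounds

section Words

variable {A : Type*}

theorem shift_iterate_apply (y : ℕ → A) (p i : ℕ) : (shift^[p] y) i = y (p + i) := by
  induction p generalizing y with
  | zero => simp
  | succ p ih =>
    rw [Function.iterate_succ_apply, ih, shift]
    congr 1
    omega

theorem seg_shift_iterate (y : ℕ → A) (p q n : ℕ) : seg (shift^[p] y) q n = seg y (p + q) n := by
  funext i
  simp only [seg, shift_iterate_apply, add_assoc]

theorem mem_cyl_iff {n : ℕ} {w : Fin n → A} {y : ℕ → A} : y ∈ cyl w ↔ seg y 0 n = w := by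
  simp [cyl, seg, funext_iff]

theorem append_seg (y : ℕ → A) (p n m : ℕ) :
    Fin.append (seg y p n) (seg y (p + n) m) = seg y p (n + m) := by
  funext i
  refine Fin.addCases (fun i => ?_) (fun i => ?_) i
  · simp [seg]
  · simp [seg, add_assoc]

theorem seg_congr {y y' : ℕ → A} {p l n : ℕ} (h : ∀ i < n, y i = y' i) (hn : p + l ≤ n) :
    seg y p l = seg y' p l :=
  funext fun i => h _ (by omega)

theorem appears_congr {x x' : ℕ → A} {N n l : ℕ} {w : Fin l → A} (h : ∀ i < n, x i = x' i)
    (hn : N ≤ n) (ha : appears N x w) : appears N x' w := by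
  obtain ⟨r, hr, hm⟩ := ha
  exact ⟨r, hr, fun i => (h _ (by omega)).symm.trans (hm i)⟩

variable [MeasurableSpace A] {μ : Measure (ℕ → A)}

theorem wp_nonneg {n : ℕ} (w : Fin n → A) : 0 ≤ wp μ w := ENNReal.toReal_nonneg

theorem wp_le_one [IsProbabilityMeasure μ] {n : ℕ} (w : Fin n → A) : wp μ w ≤ 1 :=
  ENNReal.toReal_mono ENNReal.one_ne_top prob_le_one

theorem wp_pos [IsProbabilityMeasure μ] {n : ℕ} {w : Fin n → A} (h : μ (cyl w) ≠ 0) :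
    0 < wp μ w :=
  ENNReal.toReal_pos h (measure_ne_top _ _)

theorem wp_zero [IsProbabilityMeasure μ] (w : Fin 0 → A) : wp μ w = 1 := by
  have : cyl w = Set.univ := Set.eq_univ_of_forall fun x i => i.elim0
  simp [wp, this]

theorem nullMeasurableSet_cyl {μ : Measure (ℕ → A)}
    (hμ : ∀ (i : ℕ) (a : A), NullMeasurableSet {x : ℕ → A | x i = a} μ) {n : ℕ} (w : Fin n → A) :
    NullMeasurableSet (cyl w) μ := by
  have : cyl w = ⋂ i : Fin n, {x : ℕ → A | x i = w i} := by ext x; simp [cyl]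
  rw [this]
  exact .iInter fun i => hμ i (w i)

end Words

section Cocycle

variable {A : Type*} [MeasurableSpace A]

/-- The information `-ln ℙ[y_{p+1}^{p+n}]` of a segment of `y`. -/
def info (μ : Measure (ℕ → A)) (y : ℕ → A) (p n : ℕ) : ℝ := -Real.log (wp μ (seg y p n))

/-- All segments of `y` have positive measure. -/
def SegPos (μ : Measure (ℕ → A)) (y : ℕ → A) : Prop := ∀ p n, μ (cyl (seg y p n)) ≠ 0

theorem info_shift (μ : Measure (ℕ → A)) (y : ℕ → A) (p n : ℕ) :
    info μ (shift^[p] y) 0 n = info μ y p n := by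
  rw [info, seg_shift_iterate, add_zero, info]

variable {μ : Measure (ℕ → A)} [IsProbabilityMeasure μ] {y : ℕ → A}

theorem info_zero (p : ℕ) : info μ y p 0 = 0 := by simp [info, wp_zero]

theorem info_nonneg (p n : ℕ) : 0 ≤ info μ y p n :=
  neg_nonneg.2 (Real.log_nonpos (wp_nonneg _) (wp_le_one _))

theorem abs_info_add_le {k : ℕ → ℝ} (hk : CondID μ k) (hy : SegPos μ y) (p n m : ℕ) :
    |info μ y p (n + m) - info μ y p n - info μ y (p + n) m| ≤ k n := by
  have h := hk.2.2 n m (seg y p n) (seg y (p + n) m) (pos_iff_ne_zero.2 (hy _ _))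
    (pos_iff_ne_zero.2 (hy _ _))
  rw [append_seg] at h
  have h1 := wp_pos (hy p n)
  have h2 := wp_pos (hy (p + n) m)
  have h3 := wp_pos (hy p (n + m))
  have h4 := Real.log_le_log h3 h.1
  have h5 := Real.log_le_log (by positivity) (h.2 (pos_iff_ne_zero.2 (hy _ _)))
  rw [Real.log_mul (Real.exp_pos _).ne' (by positivity), Real.log_mul h1.ne' h2.ne',
    Real.log_exp] at h4 h5
  unfold info
  rw [abs_le]
  constructor <;> linarith

theorem exists_info_one_le [Finite A] (μ : Measure (ℕ → A)) :
    ∃ C : ℝ, ∀ y p, info μ y p 1 ≤ C := by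
  obtain ⟨C, hC⟩ := (Set.finite_range fun w : Fin 1 → A => -Real.log (wp μ w)).bddAbove
  exact ⟨C, fun y p => hC ⟨_, rfl⟩⟩

theorem le_info_iff (hy : SegPos μ y) (p l : ℕ) (s : ℝ) :
    s ≤ info μ y p l ↔ wp μ (seg y p l) ≤ Real.exp (-s) := by
  rw [info, le_neg, Real.log_le_iff_le_exp (wp_pos (hy p l))]

theorem info_le_iff (hy : SegPos μ y) (p l : ℕ) (s : ℝ) :
    info μ y p l ≤ s ↔ Real.exp (-s) ≤ wp μ (seg y p l) := by
  rw [info, neg_le, Real.le_log_iff_exp_le (wp_pos (hy p l))]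

end Cocycle

section Shift

variable {A : Type*} [Fintype A] [MeasurableSpace A] {μP μQ : Measure (ℕ → A)}

theorem measure_preimage_iterate_le {α : Type*} [MeasurableSpace α] {μ : Measure α} {T : α → α}
    (hT : MeasurePreserving T μ μ) (p : ℕ) (s : Set α) : μ (T^[p] ⁻¹' s) ≤ μ s := by
  rw [← measure_toMeasurable s,
    ← (hT.iterate p).measure_preimage (measurableSet_toMeasurable μ s).nullMeasurableSet]
  exact measure_mono (Set.preimage_mono (subset_toMeasurable μ s))

theorem ae_segPos (hQ : MeasurePreserving shift μQ μQ)
    (habs : ∀ (n : ℕ) (a : Fin n → A), μP (cyl a) = 0 → μQ (cyl a) = 0) :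
    ∀ᵐ y ∂μQ, SegPos μP y := by
  refine ae_all_iff.2 fun p => ae_all_iff.2 fun n => ?_
  have h0 : ∀ᵐ y ∂μQ, μP (cyl (seg y 0 n)) ≠ 0 := by
    have : ∀ᵐ y ∂μQ, ∀ w : Fin n → A, μP (cyl w) = 0 → y ∉ cyl w :=
      ae_all_iff.2 fun w => by
        by_cases hw : μP (cyl w) = 0
        · filter_upwards [measure_eq_zero_iff_ae_notMem.1 (habs n w hw)] with y hy _ using hy
        · exact ae_of_all _ fun y h => absurd h hw
    filter_upwards [this] with y hy h
    exact hy _ h (mem_cyl_iff.2 rfl)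
  have := (hQ.iterate p).quasiMeasurePreserving.ae h0
  filter_upwards [this] with y hy
  rwa [seg_shift_iterate, add_zero] at hy

end Shift

section Entropy

theorem exists_common_limit {b e : ℕ → ℝ} (he : Tendsto e atTop (nhds 0)) {u : ℕ → ℝ}
    (hu : ∀ᶠ m in atTop, ∀ ε > 0, ∀ᶠ n in atTop, |u n - b m| ≤ e m + ε) :
    ∃ h, Tendsto b atTop (nhds h) ∧ Tendsto u atTop (nhds h) := by
  have hcau : CauchySeq u := by
    rw [Metric.cauchySeq_iff']
    intro ε hε
    obtain ⟨m, h1, h2⟩ := (hu.and (he.eventually_lt_const (show 0 < ε / 4 by positivity))).exists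
    obtain ⟨N, hN⟩ := eventually_atTop.1 (h1 (ε / 8) (by positivity))
    refine ⟨N, fun n hn => ?_⟩
    have a1 := hN n hn
    have a2 := hN N le_rfl
    rw [Real.dist_eq, abs_lt]
    rw [abs_le] at a1 a2
    constructor <;> linarith
  obtain ⟨h, hh⟩ := cauchySeq_tendsto_of_complete hcau
  refine ⟨h, ?_, hh⟩
  have hbd : ∀ᶠ m in atTop, |h - b m| ≤ e m := by
    filter_upwards [hu] with m hm
    refine le_of_forall_pos_le_add fun ε hε => ?_
    exact le_of_tendsto (hh.sub_const (b m)).abs (hm ε hε)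
  have := squeeze_zero_norm' (a := e) (f := fun m => h - b m) (by simpa using hbd) he
  simpa using (tendsto_const_nhds (x := h)).sub this

variable {A : Type*} [Fintype A] [MeasurableSpace A] {μP μQ : Measure (ℕ → A)}

theorem info_eq_sum (y : ℕ → A) (n : ℕ) :
    info μP y 0 n = ∑ w : Fin n → A, (cyl w).indicator (fun _ => -Real.log (wp μP w)) y := by
  rw [Finset.sum_eq_single (seg y 0 n)]
  · rw [Set.indicator_of_mem (mem_cyl_iff.2 rfl), info]
  · intro w _ hw
    exact Set.indicator_of_notMem (fun h => hw (mem_cyl_iff.1 h).symm) _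
  · simp

theorem integrable_info [IsProbabilityMeasure μQ]
    (hμ : ∀ (i : ℕ) (a : A), NullMeasurableSet {x : ℕ → A | x i = a} μQ) (n : ℕ) :
    Integrable (fun y => info μP y 0 n) μQ ∧
      ∫ y, info μP y 0 n ∂μQ = ∑ w : Fin n → A, wp μQ w * -Real.log (wp μP w) := by
  simp only [info_eq_sum]
  have hi : ∀ w : Fin n → A,
      Integrable ((cyl w).indicator fun _ => -Real.log (wp μP w)) μQ := fun w =>
    (integrable_const _).indicator₀ (nullMeasurableSet_cyl hμ w)
  refine ⟨integrable_finsetSum _ fun w _ => hi w, ?_⟩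
  rw [integral_finsetSum _ fun w _ => hi w]
  refine Finset.sum_congr rfl fun w _ => ?_
  rw [integral_indicator₀ (nullMeasurableSet_cyl hμ w)]
  simp [wp, Measure.real]

theorem hcSeqE_eq_ofReal [IsProbabilityMeasure μP] [IsProbabilityMeasure μQ]
    (hμ : ∀ (i : ℕ) (a : A), NullMeasurableSet {x : ℕ → A | x i = a} μQ)
    (habs : ∀ (n : ℕ) (a : Fin n → A), μP (cyl a) = 0 → μQ (cyl a) = 0) {n : ℕ} (hn : 0 < n) :
    hcSeqE μP μQ n = ENNReal.ofReal ((∫ y, info μP y 0 n ∂μQ) / n) := by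
  rw [(integrable_info hμ n).2, hcSeqE, ENNReal.ofReal_div_of_pos (by exact_mod_cast hn),
    ENNReal.ofReal_natCast, ENNReal.ofReal_sum_of_nonneg]
  · congr 1
    refine Finset.sum_congr rfl fun w _ => ?_
    rw [ENNReal.ofReal_mul (wp_nonneg _), wp, ENNReal.ofReal_toReal (measure_ne_top _ _)]
    by_cases hw : μP (cyl w) = 0
    · rw [habs n w hw]; simp
    · rw [negLog, if_neg hw]; rfl
  · intro w _
    exact mul_nonneg (wp_nonneg _)
      (neg_nonneg.2 (Real.log_nonpos (wp_nonneg _) (wp_le_one _)))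

theorem exists_crossEntropy [IsProbabilityMeasure μP] [IsProbabilityMeasure μQ]
    (hQerg : Ergodic shift μQ) {k : ℕ → ℝ} (hPID : CondID μP k)
    (hμ : ∀ (i : ℕ) (a : A), NullMeasurableSet {x : ℕ → A | x i = a} μQ)
    (habs : ∀ (n : ℕ) (a : Fin n → A), μP (cyl a) = 0 → μQ (cyl a) = 0) :
    ∃ h : ℝ, Tendsto (fun n => hcSeqE μP μQ n) atTop (nhds (ENNReal.ofReal h)) ∧
      ∀ᵐ y ∂μQ, Tendsto (fun N : ℕ => info μP y 0 N / N) atTop (nhds h) := by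
  obtain ⟨C, hC⟩ := exists_info_one_le μP
  set b : ℕ → ℝ := fun m => (∫ y, info μP y 0 m ∂μQ) / m with hb
  have hbirk : ∀ᵐ y ∂μQ, ∀ m : ℕ, Tendsto (fun n : ℕ =>
      birkhoffSum shift (fun y => info μP y 0 m) n y / n) atTop
        (nhds (∫ y, info μP y 0 m ∂μQ)) :=
    ae_all_iff.2 fun m => ae_tendsto_birkhoffSum_div hQerg (integrable_info hμ m).1
  have hgood : ∀ᵐ y ∂μQ, ∃ h, Tendsto b atTop (nhds h) ∧
      Tendsto (fun N : ℕ => info μP y 0 N / N) atTop (nhds h) := by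
    filter_upwards [hbirk, ae_segPos hQerg.toMeasurePreserving habs] with y hy hpos
    refine exists_common_limit (e := fun m => k m / m) hPID.2.1.tendsto_div_nhds_zero ?_
    filter_upwards [eventually_gt_atTop 0] with m hm ε hε
    obtain ⟨K, hK⟩ := exists_abs_mul_sub_sum_le (F := info μP y) info_zero info_nonneg
      (abs_info_add_le hPID hpos) (hC y) hPID.1 m
    have hm' : (0 : ℝ) < m := by exact_mod_cast hm
    have h1 := (Metric.tendsto_nhds.1 (hy m)) (m * (ε / 2)) (by positivity)
    filter_upwards [h1, eventually_gt_atTop 0,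
      tendsto_natCast_atTop_atTop.eventually_ge_atTop (K / (m * (ε / 2)))] with n h2 hn h3
    have hn' : (0 : ℝ) < n := by exact_mod_cast hn
    have h4 := hK n
    have h5 : birkhoffSum shift (fun y => info μP y 0 m) n y =
        ∑ j ∈ Finset.range n, info μP y j m :=
      Finset.sum_congr rfl fun j _ => info_shift μP y j m
    rw [h5, Real.dist_eq] at h2
    rw [div_le_iff₀ (by positivity)] at h3
    set S := ∑ j ∈ Finset.range n, info μP y j m
    have e1 : info μP y 0 n / n - b m = (m * info μP y 0 n - S) / (n * m) +
        (S / n - ∫ y, info μP y 0 m ∂μQ) / m := by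
      simp only [hb]
      field_simp
      ring
    have e2 : |(m * info μP y 0 n - S) / (n * m)| ≤ k m / m + ε / 2 := by
      rw [abs_div, abs_of_pos (show (0 : ℝ) < n * m by positivity), div_le_iff₀ (by positivity)]
      refine h4.trans ?_
      have : (k m / m + ε / 2) * (n * m) = n * k m + n * (m * (ε / 2)) := by
        field_simp
      rw [this]
      linarith
    have e3 : |(S / n - ∫ y, info μP y 0 m ∂μQ) / m| ≤ ε / 2 := by
      rw [abs_div, abs_of_pos hm', div_le_iff₀ hm']
      linarith
    rw [e1]
    exact (abs_add_le _ _).trans (by linarith)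
  obtain ⟨y₀, h, hbh, -⟩ := hgood.exists
  refine ⟨h, ?_, ?_⟩
  · refine (ENNReal.tendsto_ofReal hbh).congr' ?_
    filter_upwards [eventually_gt_atTop 0] with n hn
    exact (hcSeqE_eq_ofReal hμ habs hn).symm
  · filter_upwards [hgood] with y ⟨h', hb', hy⟩
    rwa [tendsto_nhds_unique hb' hbh] at hy

end Entropy

section Product

theorem prod_le_of_forall_section_le {α β : Type*} [MeasurableSpace α] [MeasurableSpace β]
    {μ : Measure α} {ν : Measure β} [SFinite μ] [IsProbabilityMeasure ν] {S : Set (α × β)}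
    (hS : NullMeasurableSet S (μ.prod ν)) {c : ℝ≥0∞} (hc : ∀ y, μ {x | (x, y) ∈ S} ≤ c) :
    (μ.prod ν) S ≤ c := by
  obtain ⟨R, hRS, hR, hRe⟩ := hS.exists_measurable_subset_ae_eq
  rw [← measure_congr hRe, Measure.prod_apply_symm hR]
  calc ∫⁻ y, μ ((fun x => (x, y)) ⁻¹' R) ∂ν ≤ ∫⁻ _, c ∂ν :=
        lintegral_mono fun y =>
        (measure_mono (show (fun x => (x, y)) ⁻¹' R ⊆ {x | (x, y) ∈ S} from
          fun x hx => hRS hx)).trans (hc y)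
    _ = c := by simp

theorem mul_measure_le_card_le {α ι : Type*} [MeasurableSpace α] {μ : Measure α}
    (s : Finset ι) {E : ι → Set α} (hE : ∀ p ∈ s, NullMeasurableSet (E p) μ) (t : ℝ≥0∞) :
    t * μ {z | t ≤ ((s.filter fun p => z ∈ E p).card : ℝ≥0∞)} ≤ ∑ p ∈ s, μ (E p) := by
  have h1 : ∀ z, ((s.filter fun p => z ∈ E p).card : ℝ≥0∞) =
      ∑ p ∈ s, (E p).indicator 1 z := by
    intro z
    rw [Finset.card_filter]
    push_cast
    exact Finset.sum_congr rfl fun p _ => by simp [Set.indicator_apply]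
  have hm : ∀ p ∈ s, AEMeasurable ((E p).indicator (1 : α → ℝ≥0∞)) μ := fun p hp =>
    (aemeasurable_indicator_const_iff (1 : ℝ≥0∞)).2 (hE p hp)
  simp only [h1]
  refine (mul_meas_ge_le_lintegral₀ (Finset.aemeasurable_fun_sum _ hm) t).trans (le_of_eq ?_)
  rw [lintegral_finsetSum' _ hm]
  exact Finset.sum_congr rfl fun p hp => lintegral_indicator_one₀ (hE p hp)

variable {A : Type*} [Fintype A] [MeasurableSpace A] {μP μQ : Measure (ℕ → A)}

theorem nullMeasurableSet_prod_of_seg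
    (hP : ∀ (i : ℕ) (a : A), NullMeasurableSet {x : ℕ → A | x i = a} μP)
    (hQ : ∀ (i : ℕ) (a : A), NullMeasurableSet {x : ℕ → A | x i = a} μQ)
    (n : ℕ) {S : Set ((ℕ → A) × (ℕ → A))}
    (hS : ∀ x x' y y', (∀ i < n, x i = x' i) → (∀ i < n, y i = y' i) →
      (x, y) ∈ S → (x', y') ∈ S) :
    NullMeasurableSet S (μP.prod μQ) := by
  have : S = ⋃ (u : Fin n → A) (v : Fin n → A)
      (_ : ∃ x y, (x, y) ∈ S ∧ seg x 0 n = u ∧ seg y 0 n = v),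
      (Prod.fst ⁻¹' cyl u) ∩ (Prod.snd ⁻¹' cyl v) := by
    ext ⟨x, y⟩
    simp only [Set.mem_iUnion, Set.mem_inter_iff, Set.mem_preimage, mem_cyl_iff, exists_prop]
    constructor
    · intro h
      exact ⟨_, _, ⟨x, y, h, rfl, rfl⟩, rfl, rfl⟩
    · rintro ⟨u, v, ⟨x', y', h, rfl, rfl⟩, hx, hy⟩
      refine hS x' x y' y (fun i hi => ?_) (fun i hi => ?_) h
      · simpa [seg] using (congrFun hx ⟨i, hi⟩).symm
      · simpa [seg] using (congrFun hy ⟨i, hi⟩).symm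
  rw [this]
  refine .iUnion fun u => .iUnion fun v => .iUnion fun _ => ?_
  exact ((nullMeasurableSet_cyl hP u).preimage Measure.quasiMeasurePreserving_fst).inter
    ((nullMeasurableSet_cyl hQ v).preimage Measure.quasiMeasurePreserving_snd)

end Product

section LongMatches

variable {A : Type*} [MeasurableSpace A] {μP μQ : Measure (ℕ → A)}

theorem measure_appears_le (hP : MeasurePreserving shift μP μP) (N : ℕ) {l : ℕ} (w : Fin l → A) :
    μP {x | appears N x w} ≤ (N + 1) * μP (cyl w) := by
  have hsub : {x | appears N x w} ⊆ ⋃ r ∈ Finset.range (N + 1), shift^[r] ⁻¹' cyl w := by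
    rintro x ⟨r, hr, hm⟩
    simp only [Set.mem_iUnion, Finset.mem_range]
    exact ⟨r, by omega, fun i => (shift_iterate_apply x r i).trans (hm i)⟩
  refine (measure_mono hsub).trans ((measure_biUnion_finset_le _ _).trans ?_)
  refine (Finset.sum_le_sum fun r _ => measure_preimage_iterate_le hP r _).trans ?_
  simp

/-- The pairs `(x, y)` such that a segment of `y` at `p` of measure at most `θ` appears
in `x_1^N`. -/
def unlikelyMatch (μ : Measure (ℕ → A)) (N : ℕ) (θ : ℝ) (p : ℕ) : Set ((ℕ → A) × (ℕ → A)) :=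
  {z | ∃ l, wp μ (seg z.2 p l) ≤ θ ∧ appears N z.1 (seg z.2 p l)}

theorem nullMeasurableSet_unlikelyMatch [Fintype A]
    (hP : ∀ (i : ℕ) (a : A), NullMeasurableSet {x : ℕ → A | x i = a} μP)
    (hQ : ∀ (i : ℕ) (a : A), NullMeasurableSet {x : ℕ → A | x i = a} μQ)
    (N : ℕ) (θ : ℝ) (p : ℕ) : NullMeasurableSet (unlikelyMatch μP N θ p) (μP.prod μQ) := by
  refine nullMeasurableSet_prod_of_seg hP hQ (N + p) ?_
  rintro x x' y y' hx hy ⟨l, hl, ha⟩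
  have hlN : l ≤ N := by
    obtain ⟨r, hr, -⟩ := ha
    omega
  have h1 : seg y p l = seg y' p l := seg_congr hy (by omega)
  simp only [h1] at hl ha
  exact ⟨l, hl, appears_congr hx (by omega) ha⟩

variable [IsProbabilityMeasure μP] [IsProbabilityMeasure μQ]

theorem measure_exists_appears_le (hP : MeasurePreserving shift μP μP) (N : ℕ) (y : ℕ → A)
    (p : ℕ) (θ : ℝ) :
    μP {x | ∃ l, wp μP (seg y p l) ≤ θ ∧ appears N x (seg y p l)} ≤
      ENNReal.ofReal ((N + 1) * θ) := by
  by_cases h : ∃ l, wp μP (seg y p l) ≤ θ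
  · have hsub : {x | ∃ l, wp μP (seg y p l) ≤ θ ∧ appears N x (seg y p l)} ⊆
        {x | appears N x (seg y p (Nat.find h))} := by
      rintro x ⟨l, hl, ha⟩
      exact appears_seg_mono (Nat.find_min' h hl) ha
    refine (measure_mono hsub).trans ((measure_appears_le hP N _).trans ?_)
    rw [ENNReal.ofReal_mul (by positivity)]
    have h1 : ENNReal.ofReal ((N : ℝ) + 1) = N + 1 := by
      rw [ENNReal.ofReal_add (by positivity) zero_le_one, ENNReal.ofReal_natCast,
        ENNReal.ofReal_one]
    rw [h1]
    gcongr
    rw [ENNReal.le_ofReal_iff_toReal_le (measure_ne_top _ _)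
      ((wp_nonneg _).trans (Nat.find_spec h))]
    exact Nat.find_spec h
  · push Not at h
    have : {x | ∃ l, wp μP (seg y p l) ≤ θ ∧ appears N x (seg y p l)} = ∅ := by
      ext x
      simp only [Set.mem_ofPred_eq, Set.mem_empty_iff_false, iff_false]
      rintro ⟨l, hl, -⟩
      exact absurd hl (not_le.2 (h l))
    simp [this]

variable [Fintype A]

theorem prod_unlikelyMatch_le (hPs : MeasurePreserving shift μP μP)
    (hP : ∀ (i : ℕ) (a : A), NullMeasurableSet {x : ℕ → A | x i = a} μP)
    (hQ : ∀ (i : ℕ) (a : A), NullMeasurableSet {x : ℕ → A | x i = a} μQ)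
    (N : ℕ) (θ : ℝ) (p : ℕ) :
    (μP.prod μQ) (unlikelyMatch μP N θ p) ≤ ENNReal.ofReal ((N + 1) * θ) :=
  prod_le_of_forall_section_le (nullMeasurableSet_unlikelyMatch hP hQ N θ p) fun y =>
    measure_exists_appears_le hPs N y p θ

theorem ae_eventually_notMem_of_le {α : Type*} [MeasurableSpace α] {μ : Measure α}
    {s : ℕ → Set α} {u : ℕ → ℝ} (hu : Summable u)
    (hs : ∀ᶠ n in atTop, μ (s n) ≤ ENNReal.ofReal (u n)) :
    ∀ᵐ x ∂μ, ∀ᶠ n in atTop, x ∉ s n := by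
  obtain ⟨n₀, h₀⟩ := eventually_atTop.1 hs
  have h1 : ∑' n, μ (s (n + n₀)) ≠ ⊤ := by
    refine ne_top_of_le_ne_top ((summable_nat_add_iff n₀).2 hu).tsum_ofReal_ne_top
      (ENNReal.tsum_le_tsum fun n => h₀ _ (by omega))
  filter_upwards [ae_eventually_notMem h1] with x hx
  obtain ⟨n₁, h₁⟩ := eventually_atTop.1 hx
  refine eventually_atTop.2 ⟨n₁ + n₀, fun n hn => ?_⟩
  have := h₁ (n - n₀) (by omega)
  rwa [Nat.sub_add_cancel (by omega)] at this

theorem ae_eventually_not_unlikelyMatch (hPs : MeasurePreserving shift μP μP)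
    (hP : ∀ (i : ℕ) (a : A), NullMeasurableSet {x : ℕ → A | x i = a} μP)
    (hQ : ∀ (i : ℕ) (a : A), NullMeasurableSet {x : ℕ → A | x i = a} μQ) :
    ∀ᵐ z ∂(μP.prod μQ), ∀ᶠ N : ℕ in atTop, ∀ p < N,
      z ∉ unlikelyMatch μP N (Real.exp (-(4 * Real.log N))) p := by
  have hsum : Summable fun N : ℕ => 2 * ((N : ℝ) ^ 2)⁻¹ :=
    (Real.summable_nat_pow_inv.2 one_lt_two).mul_left 2
  have := ae_eventually_notMem_of_le (μ := μP.prod μQ)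
    (s := fun N => ⋃ p ∈ Finset.range N, unlikelyMatch μP N (Real.exp (-(4 * Real.log N))) p)
    hsum ?_
  · filter_upwards [this] with z hz
    filter_upwards [hz] with N hN p hp hmem
    exact hN (Set.mem_biUnion (Finset.mem_coe.2 (Finset.mem_range.2 hp)) hmem)
  · filter_upwards [eventually_ge_atTop 1] with N hN
    have hN' : (1 : ℝ) ≤ N := by exact_mod_cast hN
    refine (measure_biUnion_finset_le _ _).trans
      ((Finset.sum_le_sum fun p _ => prod_unlikelyMatch_le hPs hP hQ N _ p).trans ?_)
    rw [Finset.sum_const, Finset.card_range, nsmul_eq_mul, ← ENNReal.ofReal_natCast,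
      ← ENNReal.ofReal_mul (by positivity)]
    refine ENNReal.ofReal_le_ofReal ?_
    have h4 : Real.exp (-(4 * Real.log N)) = ((N : ℝ) ^ 4)⁻¹ := by
      rw [Real.exp_neg, show (4 : ℝ) * Real.log N = (4 : ℕ) * Real.log N by norm_num,
        Real.exp_nat_mul, Real.exp_log (by positivity)]
    rw [h4]
    have h5 : (N : ℝ) * ((N + 1) * ((N : ℝ) ^ 4)⁻¹) = (N * (N + 1)) / N ^ 4 := by ring
    rw [h5, ← div_eq_mul_inv, div_le_div_iff₀ (by positivity) (by positivity)]
    nlinarith [pow_pos (show (0 : ℝ) < N by positivity) 3]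

theorem ae_eventually_card_unlikelyMatch_lt (hPs : MeasurePreserving shift μP μP)
    (hP : ∀ (i : ℕ) (a : A), NullMeasurableSet {x : ℕ → A | x i = a} μP)
    (hQ : ∀ (i : ℕ) (a : A), NullMeasurableSet {x : ℕ → A | x i = a} μQ)
    {ε : ℝ} (hε : 0 < ε) :
    ∀ᵐ z ∂(μP.prod μQ), ∀ᶠ j : ℕ in atTop,
      (((Finset.range (2 ^ j)).filter fun p =>
        z ∈ unlikelyMatch μP (2 ^ j) (((2 : ℝ) ^ j / 2) ^ (-(1 + ε))) p).card : ℝ) <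
          ((2 : ℝ) ^ j) ^ (1 - ε / 2) := by
  have hr1 : (2 : ℝ) ^ (-(ε / 2)) < 1 := Real.rpow_lt_one_of_one_lt_of_neg one_lt_two (by linarith)
  have hsum : Summable fun j : ℕ => 2 * (2 : ℝ) ^ (1 + ε) * ((2 : ℝ) ^ (-(ε / 2))) ^ j :=
    (summable_geometric_of_lt_one (by positivity) hr1).mul_left _
  have := ae_eventually_notMem_of_le (μ := μP.prod μQ)
    (s := fun j => {z | ENNReal.ofReal (((2 : ℝ) ^ j) ^ (1 - ε / 2)) ≤
      (((Finset.range (2 ^ j)).filter fun p =>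
        z ∈ unlikelyMatch μP (2 ^ j) (((2 : ℝ) ^ j / 2) ^ (-(1 + ε))) p).card : ℝ≥0∞)})
    hsum ?_
  · filter_upwards [this] with z hz
    filter_upwards [hz] with j hj
    rw [not_le, ← ENNReal.ofReal_natCast,
      ENNReal.ofReal_lt_ofReal_iff (by positivity)] at hj
    exact hj
  · refine Eventually.of_forall fun j => ?_
    set M : ℝ := (2 : ℝ) ^ j with hM
    have hM1 : 1 ≤ M := one_le_pow₀ one_le_two
    have hM0 : 0 < M := by positivity
    have h1 := mul_measure_le_card_le (μ := μP.prod μQ) (Finset.range (2 ^ j))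
      (E := unlikelyMatch μP (2 ^ j) ((M / 2) ^ (-(1 + ε))))
      (fun p _ => nullMeasurableSet_unlikelyMatch hP hQ _ _ p)
      (ENNReal.ofReal (M ^ (1 - ε / 2)))
    have h2 := h1.trans (Finset.sum_le_sum fun p _ =>
      prod_unlikelyMatch_le hPs hP hQ (2 ^ j) ((M / 2) ^ (-(1 + ε))) p)
    rw [Finset.sum_const, Finset.card_range, nsmul_eq_mul, ← ENNReal.ofReal_natCast,
      ← ENNReal.ofReal_mul (by positivity), mul_comm] at h2
    have h3 : 0 < M ^ (1 - ε / 2) := by positivity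
    rw [← ENNReal.le_div_iff_mul_le (Or.inl (by simpa using h3))
      (Or.inl ENNReal.ofReal_ne_top), ← ENNReal.ofReal_div_of_pos h3] at h2
    refine h2.trans (ENNReal.ofReal_le_ofReal ?_)
    push_cast
    rw [← hM, div_le_iff₀ h3]
    have h4 : (M / 2) ^ (-(1 + ε)) = 2 ^ (1 + ε) * M ^ (-(1 + ε)) := by
      rw [Real.div_rpow hM0.le two_pos.le, Real.rpow_neg two_pos.le, div_inv_eq_mul, mul_comm]
    have h5 : ((2 : ℝ) ^ (-(ε / 2))) ^ j = M ^ (-(ε / 2)) := by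
      rw [hM, ← Real.rpow_natCast, ← Real.rpow_natCast, ← Real.rpow_mul two_pos.le,
        ← Real.rpow_mul two_pos.le, mul_comm]
    have h6 : M * M * M ^ (-(1 + ε)) = M ^ (-(ε / 2)) * M ^ (1 - ε / 2) := by
      rw [← Real.rpow_add hM0]
      nth_rw 1 [← Real.rpow_one M]
      nth_rw 2 [← Real.rpow_one M]
      rw [← Real.rpow_add hM0, ← Real.rpow_add hM0]
      congr 1
      ring
    rw [h4, h5]
    calc M * ((M + 1) * (2 ^ (1 + ε) * M ^ (-(1 + ε))))
        ≤ M * ((M + M) * (2 ^ (1 + ε) * M ^ (-(1 + ε)))) := by gcongr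
      _ = 2 * 2 ^ (1 + ε) * (M * M * M ^ (-(1 + ε))) := by ring
      _ = _ := by rw [h6]; ring

theorem ae_tendsto_card_unlikelyMatch (hPs : MeasurePreserving shift μP μP)
    (hP : ∀ (i : ℕ) (a : A), NullMeasurableSet {x : ℕ → A | x i = a} μP)
    (hQ : ∀ (i : ℕ) (a : A), NullMeasurableSet {x : ℕ → A | x i = a} μQ)
    {ε : ℝ} (hε : 0 < ε) (hε1 : ε ≤ 1) :
    ∀ᵐ z ∂(μP.prod μQ), Tendsto (fun N : ℕ =>
      (((Finset.range N).filter fun p =>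
        z ∈ unlikelyMatch μP N (Real.exp (-((1 + ε) * Real.log N))) p).card : ℝ) *
          Real.log N / N) atTop (nhds 0) := by
  filter_upwards [ae_eventually_card_unlikelyMatch_lt hPs hP hQ hε] with z hz
  have hlim : Tendsto (fun N : ℕ => (2 : ℝ) ^ (1 - ε / 2) * (Real.log N / (N : ℝ) ^ (ε / 2)))
      atTop (nhds 0) := by
    have h := ((isLittleO_log_rpow_atTop (half_pos hε)).tendsto_div_nhds_zero.comp
      (tendsto_natCast_atTop_atTop (R := ℝ))).const_mul ((2 : ℝ) ^ (1 - ε / 2))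
    simpa using h
  have hclog : Tendsto (fun N : ℕ => Nat.clog 2 N) atTop atTop := by
    refine tendsto_atTop.2 fun b => ?_
    filter_upwards [eventually_ge_atTop (2 ^ b)] with N hN
    exact (Nat.pow_le_pow_iff_right one_lt_two).1 (hN.trans (Nat.le_pow_clog one_lt_two N))
  refine squeeze_zero' ?_ ?_ hlim
  · exact Eventually.of_forall fun N =>
      div_nonneg (mul_nonneg (Nat.cast_nonneg _) (Real.log_natCast_nonneg _)) (Nat.cast_nonneg _)
  · filter_upwards [hclog.eventually hz, eventually_gt_atTop 1] with N hj hN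
    set j := Nat.clog 2 N with hjdef
    have hN0 : (0 : ℝ) < N := by exact_mod_cast (by omega : 0 < N)
    have h1 : N ≤ 2 ^ j := Nat.le_pow_clog one_lt_two N
    have h2 : (2 : ℝ) ^ j / 2 ≤ N := by
      have h := Nat.pow_pred_clog_lt_self one_lt_two hN
      have hj0 : j ≠ 0 := by
        rintro h0
        rw [h0] at h1
        omega
      have h3 : 2 ^ j = 2 * 2 ^ (j - 1) := by
        rw [← pow_succ', Nat.sub_add_cancel (by omega)]
      have h4 : (2 : ℕ) ^ j ≤ 2 * N := by
        rw [h3]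
        have : 2 ^ (j - 1) < N := h
        omega
      have h5 : (2 : ℝ) ^ j ≤ 2 * N := by exact_mod_cast h4
      linarith
    have hθ : Real.exp (-((1 + ε) * Real.log N)) ≤ ((2 : ℝ) ^ j / 2) ^ (-(1 + ε)) := by
      rw [show -((1 + ε) * Real.log N) = Real.log N * (-(1 + ε)) by ring,
        ← Real.rpow_def_of_pos hN0]
      exact Real.rpow_le_rpow_of_nonpos (by positivity) h2 (by linarith)
    have hcard : ((Finset.range N).filter fun p =>
        z ∈ unlikelyMatch μP N (Real.exp (-((1 + ε) * Real.log N))) p).card ≤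
        ((Finset.range (2 ^ j)).filter fun p =>
        z ∈ unlikelyMatch μP (2 ^ j) (((2 : ℝ) ^ j / 2) ^ (-(1 + ε))) p).card := by
      refine Finset.card_le_card fun p hp => ?_
      simp only [Finset.mem_filter, Finset.mem_range] at hp ⊢
      obtain ⟨hpN, l, hl, r, hr, hm⟩ := hp
      exact ⟨by omega, l, hl.trans hθ, r, by omega, hm⟩
    have hlt : (((Finset.range N).filter fun p =>
        z ∈ unlikelyMatch μP N (Real.exp (-((1 + ε) * Real.log N))) p).card : ℝ) ≤
        (2 * (N : ℝ)) ^ (1 - ε / 2) :=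
      (Nat.cast_le.2 hcard).trans (hj.le.trans
        (Real.rpow_le_rpow (by positivity) (by linarith) (by linarith)))
    have hlog : 0 ≤ Real.log N := Real.log_natCast_nonneg _
    calc _ ≤ (2 * (N : ℝ)) ^ (1 - ε / 2) * Real.log N / N := by gcongr
      _ = _ := by
        rw [Real.mul_rpow two_pos.le hN0.le, Real.rpow_sub hN0, Real.rpow_one]
        field_simp

end LongMatches

section ShortMatches

variable {A : Type*}

theorem le_W_of_not_appears {N l : ℕ} (hl : l ≤ N) {w : Fin l → A} {x : ℕ → A}
    (h : ¬ appears N x w) : ((N - l + 1 : ℕ) : ℕ∞) ≤ W w x := by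
  refine le_sInf ?_
  rintro _ ⟨n, rfl, hn, hm⟩
  rw [Nat.cast_le]
  by_contra hlt
  exact h ⟨n - 1, by omega, hm⟩

theorem eventually_four_mul_le {g ε : ℝ} (hg : 0 < g) (hε : 0 < ε) :
    ∀ᶠ t : ℝ in atTop, g * Real.exp t / (6 * t) ≤ g * Real.exp t / (3 * t) - 1 ∧
      4 * t ≤ Real.exp (-(ε / 4 * t)) * Real.exp (-((1 - ε) * t)) *
        (g * Real.exp t / (6 * t)) := by
  have h1 := (tendsto_rpow_mul_exp_neg_mul_atTop_nhds_zero 2 (3 * ε / 4)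
    (by positivity)).eventually_lt_const (show 0 < g / 24 by positivity)
  have h2 := (tendsto_rpow_mul_exp_neg_mul_atTop_nhds_zero 1 1 one_pos).eventually_lt_const
    (show 0 < g / 6 by positivity)
  filter_upwards [h1, h2, eventually_gt_atTop 0] with t h1 h2 ht
  rw [Real.rpow_two, neg_mul, Real.exp_neg, ← div_eq_mul_inv, div_lt_iff₀ (Real.exp_pos _)] at h1
  rw [Real.rpow_one, neg_mul, one_mul, Real.exp_neg, ← div_eq_mul_inv,
    div_lt_iff₀ (Real.exp_pos _)] at h2
  constructor
  · have e1 : g * Real.exp t / (3 * t) = 2 * (g * Real.exp t / (6 * t)) := by ring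
    have e2 : 1 ≤ g * Real.exp t / (6 * t) := by
      rw [one_le_div (by positivity)]
      linarith
    linarith
  · have e1 : Real.exp (-(ε / 4 * t)) * Real.exp (-((1 - ε) * t)) * (g * Real.exp t / (6 * t)) =
        g * Real.exp (3 * ε / 4 * t) / (6 * t) := by
      rw [show 3 * ε / 4 * t = -(ε / 4 * t) + -((1 - ε) * t) + t by ring, Real.exp_add,
        Real.exp_add]
      ring
    rw [e1, le_div_iff₀ (by positivity)]
    nlinarith

variable [MeasurableSpace A] {μ : Measure (ℕ → A)}

theorem exists_measure_not_appears_le [IsProbabilityMeasure μ] {γ : ℝ} {k τ : ℕ → ℝ}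
    (hFE : CondFE μ γ) (hKB : CondKB μ k τ) {ε : ℝ} (hε : 0 < ε) :
    ∃ l₁ : ℕ, ∀ᶠ N : ℕ in atTop, ∀ l ≥ l₁, ∀ w : Fin l → A,
      Real.exp (-((1 - ε) * Real.log N)) ≤ wp μ w → l ≤ N ∧
        (μ {x | ¬ appears N x w}).toReal ≤ Real.exp (-(4 * Real.log N)) := by
  obtain ⟨hγ, hFE⟩ := hFE
  obtain ⟨hk, hτ, hKB⟩ := hKB
  set g := -γ with hgdef
  have hg : 0 < g := by linarith
  have hk' := hk.def (show 0 < ε * g / 4 by positivity)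
  have hτ' := hτ.def (show (0 : ℝ) < 1 / 2 by norm_num)
  obtain ⟨l₁, hl₁⟩ := eventually_atTop.1
    (hFE.and (hk'.and (hτ'.and (eventually_ge_atTop 1))))
  refine ⟨l₁, ?_⟩
  filter_upwards [tendsto_log_natCast.eventually (eventually_four_mul_le hg hε),
    tendsto_log_natCast.eventually_gt_atTop 0,
    tendsto_log_div_natCast.eventually_lt_const (show 0 < g / 2 by positivity),
    eventually_gt_atTop 0] with N h1 ht hN2 hN0 l hl w hw
  obtain ⟨a1, a2, a3, a4⟩ := hl₁ l hl
  have hN0' : (0 : ℝ) < N := by exact_mod_cast hN0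
  have hexp : Real.exp (Real.log N) = N := Real.exp_log hN0'
  rw [hexp] at h1
  set t := Real.log N with htdef
  have hl0 : (0 : ℝ) < l := by exact_mod_cast a4
  rw [Real.norm_eq_abs, Real.norm_eq_abs, abs_of_pos hl0] at a2 a3
  have hwpos : 0 < μ (cyl w) := by
    refine pos_iff_ne_zero.2 fun h0 => ?_
    rw [wp, h0] at hw
    exact absurd hw (not_le.2 (by simpa using Real.exp_pos _))
  have hgl : g * l ≤ (1 - ε) * t := by
    have := Real.exp_le_exp.1 (hw.trans (a1 w hwpos))
    rw [hgdef]
    linarith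
  have hglt : g * l ≤ t := hgl.trans (by nlinarith)
  rw [div_lt_iff₀ hN0'] at hN2
  have hlN : (l : ℝ) ≤ N / 2 := by
    by_contra hcon
    push Not at hcon
    nlinarith
  have hlN' : l ≤ N := by
    have : (l : ℝ) ≤ N := by linarith
    exact_mod_cast this
  refine ⟨hlN', ?_⟩
  have hsub : {x | ¬ appears N x w} ⊆ {x | ((N - l + 1 : ℕ) : ℕ∞) ≤ W w x} :=
    fun x hx => le_W_of_not_appears hlN' hx
  refine (ENNReal.toReal_mono (measure_ne_top _ _) (measure_mono hsub)).trans
    ((hKB l w (N - l + 1)).trans (Real.exp_le_exp.2 (neg_le_neg ?_)))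
  have hτ1 := abs_le.1 a3
  have hden : 0 < (l : ℝ) + τ l := by linarith
  have hquot : g * N / (3 * t) ≤ (((N - l + 1 : ℕ) : ℝ) - 1) / ((l : ℝ) + τ l) := by
    rw [Nat.cast_add, Nat.cast_sub hlN', Nat.cast_one, add_sub_cancel_right,
      div_le_div_iff₀ (by positivity) hden]
    have e1 : g * N * ((l : ℝ) + τ l) ≤ g * N * (3 / 2 * l) := by
      gcongr
      linarith
    have e2 : g * N * (3 / 2 * l) ≤ 3 / 2 * N * t := by
      nlinarith
    have e3 : 3 / 2 * N * t ≤ (N - l) * (3 * t) := by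
      nlinarith
    linarith
  have hfloor : g * N / (6 * t) ≤
      (⌊(((N - l + 1 : ℕ) : ℝ) - 1) / ((l : ℝ) + τ l)⌋ : ℝ) := by
    have := (Int.sub_one_lt_floor ((((N - l + 1 : ℕ) : ℝ) - 1) / ((l : ℝ) + τ l))).le
    linarith [h1.1]
  refine h1.2.trans ?_
  have hkl : Real.exp (-(ε / 4 * t)) ≤ Real.exp (-k l) := by
    refine Real.exp_le_exp.2 (neg_le_neg ((le_abs_self _).trans (a2.trans ?_)))
    nlinarith
  have hw0 := wp_nonneg (μ := μ) w
  gcongr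

variable {μP μQ : Measure (ℕ → A)} [IsProbabilityMeasure μP] [IsProbabilityMeasure μQ] [Fintype A]

theorem ae_eventually_appears
    (hP : ∀ (i : ℕ) (a : A), NullMeasurableSet {x : ℕ → A | x i = a} μP)
    (hQ : ∀ (i : ℕ) (a : A), NullMeasurableSet {x : ℕ → A | x i = a} μQ)
    {γ : ℝ} {k τ : ℕ → ℝ} (hFE : CondFE μP γ) (hKB : CondKB μP k τ) {ε : ℝ} (hε : 0 < ε) :
    ∃ l₁ : ℕ, ∀ᵐ z ∂(μP.prod μQ), ∀ᶠ N : ℕ in atTop, ∀ p < N, ∀ l ≥ l₁,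
      Real.exp (-((1 - ε) * Real.log N)) ≤ wp μP (seg z.2 p l) →
        appears N z.1 (seg z.2 p l) := by
  obtain ⟨l₁, hl₁⟩ := exists_measure_not_appears_le hFE hKB hε
  refine ⟨l₁, ?_⟩
  set E : ℕ → ℕ → ℕ → Set ((ℕ → A) × (ℕ → A)) := fun N p l =>
    {z | Real.exp (-((1 - ε) * Real.log N)) ≤ wp μP (seg z.2 p l) ∧
      ¬ appears N z.1 (seg z.2 p l)} with hE
  have hEm : ∀ N p l, NullMeasurableSet (E N p l) (μP.prod μQ) := by
    intro N p l
    refine nullMeasurableSet_prod_of_seg hP hQ (N + p + l) ?_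
    rintro x x' y y' hx hy ⟨h1, h2⟩
    have h3 : seg y p l = seg y' p l := seg_congr hy (by omega)
    simp only [h3] at h1 h2
    exact ⟨h1, fun h => h2 (appears_congr (fun i hi => (hx i hi).symm) (by omega) h)⟩
  have hsum : Summable fun N : ℕ => 2 * ((N : ℝ) ^ 2)⁻¹ :=
    (Real.summable_nat_pow_inv.2 one_lt_two).mul_left 2
  have := ae_eventually_notMem_of_le (μ := μP.prod μQ)
    (s := fun N => ⋃ q ∈ Finset.range N ×ˢ Finset.Icc l₁ N, E N q.1 q.2) hsum ?_
  · filter_upwards [this] with z hz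
    filter_upwards [hz, hl₁] with N hN hN1 p hp l hl hw
    by_contra hna
    refine hN (Set.mem_biUnion (x := (p, l)) ?_ ⟨hw, hna⟩)
    simp [hp, hl, (hN1 l hl _ hw).1]
  · filter_upwards [eventually_ge_atTop 1, hl₁] with N hN hN1
    have hN' : (1 : ℝ) ≤ N := by exact_mod_cast hN
    have hbound : ∀ q ∈ Finset.range N ×ˢ Finset.Icc l₁ N,
        (μP.prod μQ) (E N q.1 q.2) ≤ ENNReal.ofReal (Real.exp (-(4 * Real.log N))) := by
      rintro ⟨p, l⟩ hq
      simp only [Finset.mem_product, Finset.mem_range, Finset.mem_Icc] at hq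
      refine prod_le_of_forall_section_le (hEm N p l) fun y => ?_
      by_cases hw : Real.exp (-((1 - ε) * Real.log N)) ≤ wp μP (seg y p l)
      · have h1 := (hN1 l hq.2.1 _ hw).2
        rw [← ENNReal.le_ofReal_iff_toReal_le (measure_ne_top _ _) (Real.exp_pos _).le] at h1
        exact (measure_mono fun x hx => hx.2).trans h1
      · have : {x | (x, y) ∈ E N p l} = ∅ := by
          ext x
          simp [hE, hw]
        simp [this]
    refine (measure_biUnion_finset_le _ _).trans ((Finset.sum_le_sum hbound).trans ?_)
    rw [Finset.sum_const, Finset.card_product, Finset.card_range, Nat.card_Icc, nsmul_eq_mul,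
      ← ENNReal.ofReal_natCast, ← ENNReal.ofReal_mul (by positivity)]
    refine ENNReal.ofReal_le_ofReal ?_
    have h4 : Real.exp (-(4 * Real.log N)) = ((N : ℝ) ^ 4)⁻¹ := by
      rw [Real.exp_neg, show (4 : ℝ) * Real.log N = (4 : ℕ) * Real.log N by norm_num,
        Real.exp_nat_mul, Real.exp_log (by positivity)]
    have h5 : ((N * (N + 1 - l₁) : ℕ) : ℝ) ≤ N * (N + 1) := by
      exact_mod_cast Nat.mul_le_mul_left N (Nat.sub_le _ _)
    rw [h4, ← div_eq_mul_inv, ← div_eq_mul_inv, div_le_div_iff₀ (by positivity) (by positivity)]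
    refine (mul_le_mul_of_nonneg_right h5 (by positivity)).trans ?_
    nlinarith [pow_pos (show (0 : ℝ) < N by positivity) 3]

end ShortMatches

section FiniteEntropy

variable {A : Type*} [MeasurableSpace A] {μP μQ : Measure (ℕ → A)}
  [IsProbabilityMeasure μP] [IsProbabilityMeasure μQ]

theorem exists_tendsto_of_absolutelyContinuous [Fintype A] (hPs : MeasurePreserving shift μP μP)
    (hQerg : Ergodic shift μQ)
    (hP : ∀ (i : ℕ) (a : A), NullMeasurableSet {x : ℕ → A | x i = a} μP)
    (hQ : ∀ (i : ℕ) (a : A), NullMeasurableSet {x : ℕ → A | x i = a} μQ)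
    {k kKB τ : ℕ → ℝ} {γ : ℝ} (hID : CondID μP k) (hFE : CondFE μP γ) (hKB : CondKB μP kKB τ)
    (habs : ∀ (n : ℕ) (a : Fin n → A), μP (cyl a) = 0 → μQ (cyl a) = 0) :
    ∃ h : ℝ≥0∞, Tendsto (fun n => hcSeqE μP μQ n) atTop (nhds h) ∧
      ∀ᵐ z ∂(μP.prod μQ),
        Tendsto (fun N => ENNReal.ofReal (ZMest N z.1 z.2)) atTop (nhds h) := by
  obtain ⟨h, h1, h2⟩ := exists_crossEntropy hQerg hID hQ habs
  obtain ⟨C, hC⟩ := exists_info_one_le μP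
  refine ⟨ENNReal.ofReal h, h1, ?_⟩
  have hpos : ∀ m : ℕ, 0 < 1 / ((m : ℝ) + 3) := fun m => by positivity
  have hle : ∀ m : ℕ, 1 / ((m : ℝ) + 3) ≤ 1 := fun m => by
    rw [div_le_one (by positivity)]
    linarith [(m.cast_nonneg : (0 : ℝ) ≤ m)]
  choose l₁ hl₁ using fun m => ae_eventually_appears hP hQ hFE hKB (hpos m)
  have hsnd := (Measure.quasiMeasurePreserving_snd (μ := μP) (ν := μQ)).ae
    (h2.and (ae_segPos hQerg.toMeasurePreserving habs))
  filter_upwards [hsnd, ae_all_iff.2 hl₁, ae_eventually_not_unlikelyMatch hPs hP hQ,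
    ae_all_iff.2 fun m => ae_tendsto_card_unlikelyMatch hPs hP hQ (hpos m) (hle m)]
    with z ⟨hlim, hy⟩ hA hB hG
  refine ENNReal.tendsto_ofReal ?_
  refine tendsto_ZMest_of_matching (F := info μP z.2) (k := k) info_zero info_nonneg
    (abs_info_add_le hID hy) (hC z.2) hID.1 hID.2.1 hlim (fun m => ⟨l₁ m, ?_⟩) ?_ fun m => ?_
  · filter_upwards [hA m] with N hN p hp l hl hF
    exact hN p hp l hl ((info_le_iff hy _ _ _).1 hF)
  · filter_upwards [hB] with N hN p hp l ha
    by_contra hlt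
    exact hN p hp ⟨l, (le_info_iff hy _ _ _).1 (not_le.1 hlt).le, ha⟩
  · refine (hG m).congr fun N => ?_
    simp only [longMatchCount, unlikelyMatch, le_info_iff hy, Set.mem_ofPred_eq]
    congr!

end FiniteEntropy

section InfiniteEntropy

variable {A : Type*} [MeasurableSpace A] {μP μQ : Measure (ℕ → A)}

theorem exists_extension_of_measure_ne_zero [Fintype A] {n m : ℕ} (h : n ≤ m) {a : Fin n → A}
    (hQ : μQ (cyl a) ≠ 0) (hP : μP (cyl a) = 0) :
    ∃ b : Fin m → A, μQ (cyl b) ≠ 0 ∧ μP (cyl b) = 0 := by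
  by_contra hcon
  push Not at hcon
  refine hQ (measure_mono_null (t := ⋃ (b : Fin m → A) (_ : μQ (cyl b) = 0), cyl b) ?_ ?_)
  · intro x hx
    simp only [Set.mem_iUnion]
    refine ⟨seg x 0 m, ?_, mem_cyl_iff.2 rfl⟩
    by_contra h0
    have hsub : cyl (seg x 0 m) ⊆ cyl a := by
      intro x' hx' i
      have h1 := hx' ⟨i, by omega⟩
      have h2 := hx i
      simpa [seg, h2] using h1
    exact hcon _ h0 (measure_mono_null hsub hP)
  · exact measure_iUnion_null fun b => measure_iUnion_null fun hb => hb

theorem tendsto_hcSeqE_top [Fintype A] {n : ℕ} {a : Fin n → A} (hQ : μQ (cyl a) ≠ 0)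
    (hP : μP (cyl a) = 0) : Tendsto (fun m => hcSeqE μP μQ m) atTop (nhds ⊤) := by
  refine tendsto_const_nhds.congr' ?_
  filter_upwards [eventually_ge_atTop n] with m hm
  obtain ⟨b, hb1, hb2⟩ := exists_extension_of_measure_ne_zero hm hQ hP
  have : ∑ b : Fin m → A, μQ (cyl b) * negLog (μP (cyl b)) = ⊤ := by
    refine ENNReal.sum_eq_top.2 ⟨b, Finset.mem_univ _, ?_⟩
    rw [negLog, if_pos hb2, ENNReal.mul_top hb1]
  rw [hcSeqE, this, ENNReal.top_div_of_ne_top (ENNReal.natCast_ne_top m)]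

theorem ae_tendsto_top [IsProbabilityMeasure μP] [IsProbabilityMeasure μQ]
    (hPs : MeasurePreserving shift μP μP)
    (hQerg : Ergodic shift μQ) {n : ℕ} (hn : 1 ≤ n) {U : Set (Fin n → A)}
    (hU : NullMeasurableSet {y | seg y 0 n ∈ U} μQ) (hP : μP {y | seg y 0 n ∈ U} = 0)
    (hQ : μQ {y | seg y 0 n ∈ U} ≠ 0) :
    ∀ᵐ z ∂(μP.prod μQ),
      Tendsto (fun N => ENNReal.ofReal (ZMest N z.1 z.2)) atTop (nhds ⊤) := by
  set D : Set (ℕ → A) := {y | seg y 0 n ∈ U} with hD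
  have hit : ∀ (y : ℕ → A) r, shift^[r] y ∈ D ↔ seg y r n ∈ U := fun y r => by
    show seg (shift^[r] y) 0 n ∈ U ↔ _
    rw [seg_shift_iterate, add_zero]
  have h1 : ∀ᵐ x ∂μP, ∀ r, seg x r n ∉ U := by
    refine ae_all_iff.2 fun r => ?_
    have := measure_eq_zero_iff_ae_notMem.1
      (le_antisymm ((measure_preimage_iterate_le hPs r D).trans hP.le) zero_le)
    filter_upwards [this] with x hx h
    exact hx ((hit x r).2 h)
  have hint : Integrable (D.indicator fun _ => (1 : ℝ)) μQ := (integrable_const _).indicator₀ hU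
  have h2 := ae_tendsto_birkhoffSum_div hQerg hint
  have hI : ∫ y, D.indicator (fun _ => (1 : ℝ)) y ∂μQ = (μQ D).toReal := by
    rw [integral_indicator₀ hU]
    simp [Measure.real]
  rw [hI] at h2
  set c := (μQ D).toReal with hc
  have hc0 : 0 < c := ENNReal.toReal_pos hQ (measure_ne_top _ _)
  filter_upwards [(Measure.quasiMeasurePreserving_fst (μ := μP) (ν := μQ)).ae h1,
    (Measure.quasiMeasurePreserving_snd (μ := μP) (ν := μQ)).ae h2] with z hx hy
  refine ENNReal.tendsto_ofReal_nhds_top.2 ?_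
  have hn0 : (0 : ℝ) < n := by exact_mod_cast hn
  refine tendsto_atTop_mono' atTop ?_
    (tendsto_log_natCast.const_mul_atTop (show 0 < c / 2 / n by positivity))
  filter_upwards [hy.eventually_const_lt (half_lt_self hc0), eventually_gt_atTop 0] with N hN hN0
  have hN0' : (0 : ℝ) < N := by exact_mod_cast hN0
  have hS : birkhoffSum shift (D.indicator fun _ => (1 : ℝ)) N z.2 =
      ((Finset.range N).filter fun q => seg z.2 q n ∈ U).card := by
    rw [birkhoffSum, Finset.card_filter]
    push_cast
    exact Finset.sum_congr rfl fun q _ => by simp [Set.indicator_apply, hit]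
  have hcard : (((Finset.range N).filter fun q => seg z.2 q n ∈ U).card : ℝ) ≤
      n * cN N z.1 z.2 := by
    exact_mod_cast card_occurrences_le hn hx
  rw [hS, lt_div_iff₀ hN0'] at hN
  have hlog : 0 ≤ Real.log N := Real.log_natCast_nonneg _
  rw [ZMest, mul_div_right_comm]
  refine mul_le_mul_of_nonneg_right ?_ hlog
  rw [div_le_div_iff₀ hn0 hN0']
  linarith

end InfiniteEntropy

section Inseparable

variable {A : Type*} [MeasurableSpace A]

/-- Measurable sets of sequences do not distinguish sequences with letterwise
indistinguishable coordinates. -/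
theorem mem_iff_mem_of_forall_mem_iff {x x' : ℕ → A}
    (h : ∀ i (s : Set A), MeasurableSet s → (x i ∈ s ↔ x' i ∈ s)) {S : Set (ℕ → A)}
    (hS : MeasurableSet S) : x ∈ S ↔ x' ∈ S := by
  let φ : Bool → ℕ → A := fun b => if b then x else x'
  have hφ : @Measurable Bool (ℕ → A) ⊥ _ φ := by
    refine @measurable_pi_lambda Bool ℕ (fun _ => A) ⊥ _ φ fun i => ?_
    intro s hs
    rw [MeasurableSpace.measurableSet_bot_iff]
    by_cases hx : x i ∈ s
    · right
      ext b
      cases b <;> simp [φ, hx, (h i s hs).1 hx]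
    · left
      ext b
      cases b <;> simp [φ, hx, mt (h i s hs).2 hx]
  have := hφ hS
  rw [MeasurableSpace.measurableSet_bot_iff] at this
  rcases this with h0 | h0
  · have e1 : true ∉ φ ⁻¹' S := by simp [h0]
    have e2 : false ∉ φ ⁻¹' S := by simp [h0]
    simp only [φ, Set.mem_preimage] at e1 e2
    simp_all
  · have e1 : true ∈ φ ⁻¹' S := by simp [h0]
    have e2 : false ∈ φ ⁻¹' S := by simp [h0]
    simp only [φ, Set.mem_preimage] at e1 e2
    simp_all

/-- A non-measurable letter is indistinguishable from some other letter. -/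
theorem exists_indistinguishable [Finite A] {b : A} (hb : ¬ MeasurableSet {b}) :
    ∃ b' ≠ b, ∀ s : Set A, MeasurableSet s → (b ∈ s ↔ b' ∈ s) := by
  by_contra hcon
  push Not at hcon
  have h1 : ∀ b' ≠ b, ∃ s : Set A, MeasurableSet s ∧ b ∈ s ∧ b' ∉ s := by
    intro b' hb'
    obtain ⟨s, hs, h⟩ := hcon b' hb'
    rcases h with ⟨h, h'⟩ | ⟨h, h'⟩
    · exact ⟨s, hs, h, h'⟩
    · exact ⟨sᶜ, hs.compl, h, fun hc => hc h'⟩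
  choose s hs hbs hbs' using h1
  refine hb ?_
  have : ({b} : Set A) = ⋂ (b' : A) (h : b' ≠ b), s b' h := by
    ext c
    simp only [Set.mem_singleton_iff, Set.mem_iInter]
    constructor
    · rintro rfl b' h
      exact hbs b' h
    · intro h
      by_contra hc
      exact hbs' c hc (h c hc)
  rw [this]
  exact .iInter fun b' => .iInter fun h => hs b' h

theorem measure_le_W_eq_one [Finite A] {μ : Measure (ℕ → A)} [IsProbabilityMeasure μ] {b : A}
    (hb : ¬ MeasurableSet {b}) {n : ℕ} {a : Fin n → A} {i : Fin n} (ha : a i = b) (r : ℕ∞) :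
    μ {x | r ≤ W a x} = 1 := by
  obtain ⟨b', hb', hsep⟩ := exists_indistinguishable hb
  rw [← measure_toMeasurable]
  have huniv : toMeasurable μ {x | r ≤ W a x} = Set.univ := by
    refine Set.eq_univ_of_forall fun x => ?_
    set x' : ℕ → A := fun j => if x j = b then b' else x j with hx'
    have hmem : x' ∈ {x | r ≤ W a x} := by
      show r ≤ W a x'
      have : W a x' = ⊤ := by
        refine sInf_eq_top.2 ?_
        rintro _ ⟨m, -, -, hm⟩
        have h1 := hm i
        rw [ha, hx'] at h1
        dsimp only at h1
        split_ifs at h1 with h2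
        · exact absurd h1 hb'
        · exact absurd h1 h2
      rw [this]
      exact le_top
    refine (mem_iff_mem_of_forall_mem_iff (x := x') (x' := x) (fun j s hs => ?_)
      (measurableSet_toMeasurable μ _)).1 (subset_toMeasurable μ _ hmem)
    simp only [hx']
    split_ifs with h
    · rw [h]
      exact (hsep s hs).symm
    · rfl
  rw [huniv, measure_univ]

theorem measure_letter_eq_zero [Fintype A] {μ : Measure (ℕ → A)} [IsProbabilityMeasure μ]
    (hs : MeasurePreserving shift μ μ) {k τ : ℕ → ℝ} (hKB : CondKB μ k τ) {b : A}
    (hb : ¬ MeasurableSet {b}) (i : ℕ) : μ {x | x i = b} = 0 := by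
  obtain ⟨-, hτ, hKB⟩ := hKB
  obtain ⟨l, hl1, hl⟩ := ((eventually_ge_atTop 1).and
    (hτ.def (show (0 : ℝ) < 1 / 2 by norm_num))).exists
  have hl0 : (0 : ℝ) < l := by exact_mod_cast hl1
  rw [Real.norm_eq_abs, Real.norm_eq_abs, abs_of_pos hl0] at hl
  have hτ1 := abs_le.1 hl
  have hcyl : ∀ a : Fin l → A, a ⟨0, hl1⟩ = b → μ (cyl a) = 0 := by
    intro a ha
    by_contra hpos
    have hw := wp_pos hpos
    have h1 := hKB l a (2 * l + 1)
    rw [measure_le_W_eq_one hb ha, ENNReal.toReal_one, Real.one_le_exp_iff, neg_nonneg] at h1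
    have h2 : (1 : ℝ) ≤ (⌊(((2 * l + 1 : ℕ) : ℝ) - 1) / ((l : ℝ) + τ l)⌋ : ℝ) := by
      have : (1 : ℤ) ≤ ⌊(((2 * l + 1 : ℕ) : ℝ) - 1) / ((l : ℝ) + τ l)⌋ := by
        rw [Int.le_floor]
        push_cast
        rw [le_div_iff₀ (by linarith)]
        linarith
      exact_mod_cast this
    have h3 : 0 < Real.exp (-k l) * wp μ a := by positivity
    nlinarith
  have h0 : μ {x | x 0 = b} = 0 := by
    refine measure_mono_null (t := ⋃ (a : Fin l → A) (_ : a ⟨0, hl1⟩ = b), cyl a) ?_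
      (measure_iUnion_null fun a => measure_iUnion_null fun ha => hcyl a ha)
    intro x hx
    simp only [Set.mem_iUnion]
    exact ⟨seg x 0 l, by simpa [seg] using hx, mem_cyl_iff.2 rfl⟩
  have h1 := measure_preimage_iterate_le hs i {x | x 0 = b}
  have h2 : shift^[i] ⁻¹' {x | x 0 = b} = {x : ℕ → A | x i = b} := by
    ext x
    show (shift^[i] x) 0 = b ↔ _
    rw [shift_iterate_apply, add_zero]
    rfl
  rw [h2, h0] at h1
  exact le_antisymm h1 zero_le

theorem nullMeasurableSet_letter {μ : Measure (ℕ → A)}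
    (h : ∀ b : A, ¬ MeasurableSet {b} → ∀ i, μ {x | x i = b} = 0) (i : ℕ) (a : A) :
    NullMeasurableSet {x : ℕ → A | x i = a} μ := by
  by_cases ha : MeasurableSet {a}
  · exact (measurable_pi_apply (X := fun _ : ℕ => A) i ha).nullMeasurableSet
  · exact .of_null (h a ha i)

end Inseparable

/-- **Theorem (Ziv–Merhav beyond Markovianity).** If the stationary probability measure `ℙ`
satisfies (ID), (FE) and (KB), and the ergodic stationary probability measure `ℚ` satisfies
(ID) and (FE), then the specific cross entropy `h_c(ℚ|ℙ)` exists in `[0,∞]` and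
`Q̂_N(y,x) → h_c(ℚ|ℙ)` for `(ℙ ⊗ ℚ)`-a.e. pair `(x, y)` (the limit being `+∞`, i.e.
convergence to `⊤` in `[0,∞]`, when `h_c(ℚ|ℙ) = ∞`). -/
theorem ziv_merhav {A : Type*} [Fintype A] [MeasurableSpace A]
    (μP μQ : Measure (ℕ → A)) [IsProbabilityMeasure μP] [IsProbabilityMeasure μQ]
    (hPstat : MeasurePreserving shift μP μP)
    (hQerg : Ergodic shift μQ)
    (kP kKB τKB kQ : ℕ → ℝ) (γP γQ : ℝ)
    (hPID : CondID μP kP) (hPFE : CondFE μP γP) (hPKB : CondKB μP kKB τKB)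
    (hQID : CondID μQ kQ) (hQFE : CondFE μQ γQ) :
    ∃ h : ℝ≥0∞, Tendsto (fun n => hcSeqE μP μQ n) atTop (nhds h) ∧
      ∀ᵐ z ∂(μP.prod μQ),
        Tendsto (fun N => ENNReal.ofReal (ZMest N z.1 z.2)) atTop (nhds h) := by
  have hPB := fun (b : A) hb => measure_letter_eq_zero hPstat hPKB (b := b) hb
  have hP := nullMeasurableSet_letter hPB
  set U : Set (Fin 1 → A) := {w | ¬ MeasurableSet {w 0}} with hU
  have hseg : {y | seg y 0 1 ∈ U} = {y : ℕ → A | ¬ MeasurableSet {y 0}} := rfl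
  by_cases hQB : μQ {y : ℕ → A | ¬ MeasurableSet {y 0}} = 0
  · have hQB0 : ∀ b : A, ¬ MeasurableSet {b} → ∀ i, μQ {y | y i = b} = 0 := by
      intro b hb i
      refine measure_mono_null (t := shift^[i] ⁻¹' {y : ℕ → A | ¬ MeasurableSet {y 0}}) ?_
        (le_antisymm ((measure_preimage_iterate_le hQerg.toMeasurePreserving i _).trans hQB.le)
          zero_le)
      intro y hy
      show ¬ MeasurableSet {(shift^[i] y) 0}
      rw [shift_iterate_apply, add_zero, show y i = b from hy]
      exact hb
    have hQ := nullMeasurableSet_letter hQB0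
    by_cases habs : ∀ (n : ℕ) (a : Fin n → A), μP (cyl a) = 0 → μQ (cyl a) = 0
    · exact exists_tendsto_of_absolutelyContinuous hPstat hQerg hP hQ hPID hPFE hPKB habs
    · push Not at habs
      obtain ⟨n, a, h1, h2⟩ := habs
      have hn : 1 ≤ n := by
        by_contra hn
        obtain rfl : n = 0 := by omega
        have := wp_zero (μ := μP) a
        rw [wp, h1] at this
        simp at this
      have hcyl : {y | seg y 0 n ∈ ({a} : Set (Fin n → A))} = cyl a := by
        ext y
        exact mem_cyl_iff.symm
      refine ⟨⊤, tendsto_hcSeqE_top h2 h1, ae_tendsto_top hPstat hQerg hn (U := {a}) ?_ ?_ ?_⟩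
      · rw [hcyl]
        exact nullMeasurableSet_cyl hQ a
      · rwa [hcyl]
      · rwa [hcyl]
  · have hPU : μP {y : ℕ → A | ¬ MeasurableSet {y 0}} = 0 := by
      refine measure_mono_null (t := ⋃ (b : A) (_ : ¬ MeasurableSet {b}), {y | y 0 = b}) ?_
        (measure_iUnion_null fun b => measure_iUnion_null fun hb => hPB b hb 0)
      intro y hy
      simp only [Set.mem_iUnion]
      exact ⟨y 0, hy, rfl⟩
    have hmeas : MeasurableSet {b : A | ¬ MeasurableSet {b}} := by
      rw [← MeasurableSet.compl_iff]
      have : {b : A | ¬ MeasurableSet {b}}ᶜ = ⋃ (b : A) (_ : MeasurableSet {b}), {b} := by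
        ext c
        simp
      rw [this]
      exact .iUnion fun b => .iUnion fun hb => hb
    obtain ⟨a, ha, ha'⟩ : ∃ a : Fin 1 → A, a ∈ U ∧ μQ (cyl a) ≠ 0 := by
      by_contra hcon
      push Not at hcon
      refine hQB (measure_mono_null (t := ⋃ (a : Fin 1 → A) (_ : a ∈ U), cyl a) ?_
        (measure_iUnion_null fun a => measure_iUnion_null fun ha => hcon a ha))
      intro y hy
      simp only [Set.mem_iUnion]
      exact ⟨seg y 0 1, hy, mem_cyl_iff.2 rfl⟩
    have haP : μP (cyl a) = 0 := by
      refine measure_mono_null (fun y hy => ?_) hPU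
      rw [mem_cyl_iff] at hy
      rw [← hseg]
      show seg y 0 1 ∈ U
      rwa [hy]
    exact ⟨⊤, tendsto_hcSeqE_top ha' haP, ae_tendsto_top hPstat hQerg le_rfl (U := U)
      (measurable_pi_apply (X := fun _ : ℕ => A) 0 hmeas).nullMeasurableSet hPU hQB⟩

end ZM
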